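/- arXiv:1102.5019 — 3 statements merged into one kernel-verified Lean document; each statement's English description precedes it below -/
import Mathlib

section
/- Let ε be a real-valued random variable whose distribution is symmetric and whose distribution function satisfies assumption ⟨A⟩. Then P(ε ≥ 1/2) < 1/2. (In the notation of the imaging model with unit noise level, this says P₀(Y ≥ 1/2) < 1/2, the probability that a background pixel exceeds the threshold 1/2.) -/
open MeasureTheory

/-- Proposition 1, first part: for symmetric noise `ε` satisfying assumption `⟨A⟩`
(the distribution function of `ε` is constant on no open interval of length `≥ 1`),
a background pixel `Y = ε` exceeds the threshold `1/2` with probability `< 1/2`. -/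
theorem background_pixel_threshold {Ω : Type*} [MeasurableSpace Ω] (P : Measure Ω) [IsProbabilityMeasure P]
    (ε : Ω → ℝ) (hmeas : Measurable ε)
    (hsym : P.map ε = P.map (fun x => -ε x))
    (hA : ∀ a b C : ℝ, (∀ t ∈ Set.Ioo a b, (P {x | ε x ≤ t}).toReal = C) → b - a < 1) :
    P {x | (1 : ℝ) / 2 ≤ ε x} < 1 / 2 := by
  by_contra! h
  have hsymm : P {x | ε x ≤ -(1 / 2)} = P {x | (1 : ℝ) / 2 ≤ ε x} := by
    have key := congrArg (fun μ => μ (Set.Ici ((1 : ℝ) / 2))) hsym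
    have hneg : Measurable fun x => -ε x := hmeas.neg
    simp only [Measure.map_apply hmeas measurableSet_Ici,
      Measure.map_apply hneg measurableSet_Ici] at key
    have hset : {x | ε x ≤ -(1 / 2)} = (fun x => -ε x) ⁻¹' Set.Ici ((1 : ℝ) / 2) := by
      ext x
      simp only [Set.mem_ofPred_eq, Set.mem_preimage, Set.mem_Ici, le_neg]
    rw [hset, ← key]
    rfl
  have hreal : (1 : ℝ) / 2 ≤ P.real {x | (1 : ℝ) / 2 ≤ ε x} := by
    simpa [Measure.real] using ENNReal.toReal_mono (measure_ne_top P _) h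
  have hconst : ∀ t ∈ Set.Ioo (-(1 / 2) : ℝ) (1 / 2), (P {x | ε x ≤ t}).toReal = 1 / 2 := by
    intro t ht
    change P.real {x | ε x ≤ t} = 1 / 2
    have hlower : P.real {x | ε x ≤ -(1 / 2)} ≤ P.real {x | ε x ≤ t} :=
      measureReal_mono fun x (hx : ε x ≤ -(1 / 2)) => hx.trans ht.1.le
    have hleft : P.real {x | ε x ≤ -(1 / 2)} = P.real {x | (1 : ℝ) / 2 ≤ ε x} :=
      congrArg ENNReal.toReal hsymm
    have hupper : P.real {x | (1 : ℝ) / 2 ≤ ε x} ≤ P.real {x | ε x ≤ t}ᶜ :=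
      measureReal_mono fun x (hx : 1 / 2 ≤ ε x) => not_le.mpr (ht.2.trans_le hx)
    rw [probReal_compl_eq_one_sub (measurableSet_le hmeas measurable_const)] at hupper
    linarith
  have hlen := hA _ _ _ hconst
  norm_num at hlen
end

section
/- Let ε be a real-valued random variable whose distribution is symmetric and whose distribution function satisfies assumption ⟨A⟩. Then the threshold θ = 1/2 satisfies both key inequalities on the triangular lattice: P(ε ≥ 1/2) < p_c^site(𝕋²) and p_c^site(𝕋²) < P(1 + ε ≥ 1/2). -/
open MeasureTheory

abbrev Site := ℤ × ℤ
abbrev Config := Site → Bool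

def triAdj (u v : Site) : Prop :=
  u - v ∈ ({(1, 0), (-1, 0), (0, 1), (0, -1), (1, 1), (-1, -1)} : Set Site)

def IsSitePercolation (q : Site → ℝ) (μ : Measure Config) : Prop :=
  IsProbabilityMeasure μ ∧
  ∀ (S : Finset Site) (f : Site → Bool),
    μ {ω | ∀ v ∈ S, ω v = f v} =
      ∏ v ∈ S, if f v then ENNReal.ofReal (q v) else ENNReal.ofReal (1 - q v)

def IsBernoulliPercolation (p : ℝ) (μ : Measure Config) : Prop :=
  IsSitePercolation (fun _ => p) μ

def IsOpenPath (ω : Config) (l : List Site) : Prop :=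
  l ≠ [] ∧ l.Chain' triAdj ∧ ∀ v ∈ l, ω v = true

def openCluster (ω : Config) (v : Site) : Set Site :=
  {w | ∃ l : List Site, IsOpenPath ω l ∧ l.head? = some v ∧ l.getLast? = some w}

/-- The `N × N` screen `{0, …, N−1}²`. -/
def screen (N : ℕ) : Set Site :=
  {v | 0 ≤ v.1 ∧ v.1 < N ∧ 0 ≤ v.2 ∧ v.2 < N}

/-- The box `[0, n]² = {0, …, n} × {0, …, n}`. -/
def box (n : ℕ) : Set Site :=
  {v | 0 ≤ v.1 ∧ v.1 ≤ n ∧ 0 ≤ v.2 ∧ v.2 ≤ n}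

/-- `S` is connected with respect to the triangular-lattice adjacency: any two
of its sites are joined by a path staying inside `S`. -/
def ConnectedIn (S : Set Site) : Prop :=
  ∀ u ∈ S, ∀ w ∈ S, ∃ l : List Site, l.head? = some u ∧ l.getLast? = some w ∧
    l.Chain' triAdj ∧ ∀ v ∈ l, v ∈ S

/-- The event `F_N(n)`: the screen `{0, …, N−1}²` contains a connected set of at
least `n` open sites. -/
def ClusterEvent (N n : ℕ) : Set Config :=
  {ω | ∃ S : Finset Site, ↑S ⊆ screen N ∧ n ≤ S.card ∧ ConnectedIn ↑S ∧ ∀ v ∈ S, ω v = true}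

/-- `l` is a left–right crossing of the box `[0, n]²` all of whose sites carry
the colour `b` (`true` = open/black, `false` = closed/white). -/
def IsLRCrossing (n : ℕ) (b : Bool) (ω : Config) (l : List Site) : Prop :=
  l.Chain' triAdj ∧ (∀ v ∈ l, v ∈ box n ∧ ω v = b) ∧
  (∃ u, l.head? = some u ∧ u.1 = 0) ∧ (∃ w, l.getLast? = some w ∧ w.1 = n)

/-- `l` is a top–bottom crossing of the box `[0, n]²` all of whose sites carry
the colour `b`. -/
def IsTBCrossing (n : ℕ) (b : Bool) (ω : Config) (l : List Site) : Prop :=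
  l.Chain' triAdj ∧ (∀ v ∈ l, v ∈ box n ∧ ω v = b) ∧
  (∃ u, l.head? = some u ∧ u.2 = n) ∧ (∃ w, l.getLast? = some w ∧ w.2 = 0)

/-- The event `A_n`: there is an open left–right crossing of the box `[0, n]²`. -/
def EventA (n : ℕ) : Set Config := {ω | ∃ l, IsLRCrossing n true ω l}

/-- The event `B_n`: there is a closed top–bottom crossing of the box `[0, n]²`. -/
def EventB (n : ℕ) : Set Config := {ω | ∃ l, IsTBCrossing n false ω l}

/-- There exist `k` pairwise vertex-disjoint open left–right crossings of `[0, n]²`. -/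
def HasDisjointCrossings (n : ℕ) (ω : Config) (k : ℕ) : Prop :=
  ∃ L : Fin k → List Site, (∀ i, IsLRCrossing n true ω (L i)) ∧
    ∀ i j, i ≠ j → ∀ v, v ∈ L i → v ∉ L j

/-- The critical probability for site percolation on the triangular lattice:
the supremum of those `p ∈ [0,1]` for which the open cluster of the origin is
almost surely finite. -/
noncomputable def pcSite : ℝ :=
  sSup {p : ℝ | p ∈ Set.Icc (0 : ℝ) 1 ∧
    ∀ μ : Measure Config, IsBernoulliPercolation p μ →
      μ {ω | (openCluster ω (0, 0)).Infinite} = 0}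

namespace TriPerc

section Bernoulli

variable {α : Type*} [DecidableEq α]

/-- Expectation of `f` under Bernoulli site percolation of parameter `p` on the finite set `Λ`,
a configuration being identified with its set of open sites. -/
noncomputable def bexp (p : ℝ) (Λ : Finset α) (f : Finset α → ℝ) : ℝ :=
  ∑ ω ∈ Λ.powerset, p ^ ω.card * (1 - p) ^ (Λ \ ω).card * f ω

/-- The real indicator of a proposition. -/
noncomputable def ind (P : Prop) : ℝ := open Classical in if P then 1 else 0

/-- Probability of the event `A` under Bernoulli percolation on `Λ`. -/
noncomputable def bprob (p : ℝ) (Λ : Finset α) (A : Finset α → Prop) : ℝ :=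
  bexp p Λ fun ω => ind (A ω)

lemma ind_true {P : Prop} (h : P) : ind P = 1 := by simp [ind, h]

lemma ind_false {P : Prop} (h : ¬ P) : ind P = 0 := by simp [ind, h]

lemma ind_nonneg (P : Prop) : 0 ≤ ind P := by unfold ind; split_ifs <;> norm_num

lemma ind_le_one (P : Prop) : ind P ≤ 1 := by unfold ind; split_ifs <;> norm_num

lemma ind_mono {P Q : Prop} (h : P → Q) : ind P ≤ ind Q := by
  by_cases hP : P
  · rw [ind_true hP, ind_true (h hP)]
  · rw [ind_false hP]; exact ind_nonneg Q

lemma ind_congr {P Q : Prop} (h : P ↔ Q) : ind P = ind Q := by rw [propext h]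

lemma ind_not (P : Prop) : ind (¬ P) = 1 - ind P := by
  by_cases hP : P <;> simp [ind, hP]

lemma ind_and (P Q : Prop) : ind (P ∧ Q) = ind P * ind Q := by
  by_cases hP : P <;> by_cases hQ : Q <;> simp [ind, hP, hQ]

lemma ind_or_le (P Q : Prop) : ind (P ∨ Q) ≤ ind P + ind Q := by
  by_cases hP : P <;> by_cases hQ : Q <;> simp [ind, hP, hQ]

lemma ind_exists_le {β : Type*} (s : Finset β) (P : β → Prop) :
    ind (∃ x ∈ s, P x) ≤ ∑ x ∈ s, ind (P x) := by
  by_cases h : ∃ x ∈ s, P x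
  · obtain ⟨x, hx, hP⟩ := h
    rw [ind_true ⟨x, hx, hP⟩, ← ind_true hP]
    exact Finset.single_le_sum (f := fun x => ind (P x)) (fun y _ => ind_nonneg _) hx
  · rw [ind_false h]; exact Finset.sum_nonneg fun y _ => ind_nonneg _

lemma bexp_empty (p : ℝ) (f : Finset α → ℝ) : bexp p ∅ f = f ∅ := by simp [bexp]

lemma bexp_insert (p : ℝ) {Λ : Finset α} {v : α} (hv : v ∉ Λ) (f : Finset α → ℝ) :
    bexp p (insert v Λ) f
      = p * bexp p Λ (fun ω => f (insert v ω)) + (1 - p) * bexp p Λ f := by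
  unfold bexp
  rw [Finset.sum_powerset_insert hv, add_comm, Finset.mul_sum, Finset.mul_sum]
  congr 1
  · refine Finset.sum_congr rfl fun ω hω => ?_
    have hvω : v ∉ ω := fun h => hv (Finset.mem_powerset.1 hω h)
    rw [Finset.card_insert_of_notMem hvω]
    have : insert v Λ \ insert v ω = Λ \ ω := by grind
    rw [this, pow_succ]; ring
  · refine Finset.sum_congr rfl fun ω hω => ?_
    have hvω : v ∉ ω := fun h => hv (Finset.mem_powerset.1 hω h)
    have : insert v Λ \ ω = insert v (Λ \ ω) := by grind
    rw [this, Finset.card_insert_of_notMem (by grind), pow_succ]; ring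

lemma bexp_congr (p : ℝ) {Λ : Finset α} {f g : Finset α → ℝ} (h : ∀ ω ⊆ Λ, f ω = g ω) :
    bexp p Λ f = bexp p Λ g :=
  Finset.sum_congr rfl fun ω hω => by rw [h ω (Finset.mem_powerset.1 hω)]

lemma bexp_mono {p : ℝ} (hp : p ∈ Set.Icc (0 : ℝ) 1) {Λ : Finset α} {f g : Finset α → ℝ}
    (h : ∀ ω ⊆ Λ, f ω ≤ g ω) : bexp p Λ f ≤ bexp p Λ g :=
  Finset.sum_le_sum fun ω hω => mul_le_mul_of_nonneg_left (h ω (Finset.mem_powerset.1 hω))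
    (mul_nonneg (pow_nonneg hp.1 _) (pow_nonneg (by linarith [hp.2]) _))

lemma bexp_add (p : ℝ) (Λ : Finset α) (f g : Finset α → ℝ) :
    bexp p Λ (fun ω => f ω + g ω) = bexp p Λ f + bexp p Λ g := by
  simp [bexp, mul_add, Finset.sum_add_distrib]

lemma bexp_sub (p : ℝ) (Λ : Finset α) (f g : Finset α → ℝ) :
    bexp p Λ (fun ω => f ω - g ω) = bexp p Λ f - bexp p Λ g := by
  simp [bexp, mul_sub, Finset.sum_sub_distrib]

lemma bexp_sum (p : ℝ) (Λ : Finset α) {β : Type*} (s : Finset β) (f : β → Finset α → ℝ) :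
    bexp p Λ (fun ω => ∑ x ∈ s, f x ω) = ∑ x ∈ s, bexp p Λ (f x) := by
  simp only [bexp, Finset.mul_sum]
  exact Finset.sum_comm

lemma bexp_const (p : ℝ) (Λ : Finset α) (c : ℝ) : bexp p Λ (fun _ => c) = c := by
  induction Λ using Finset.induction_on with
  | empty => exact bexp_empty p _
  | insert v Λ hv ih => rw [bexp_insert p hv, ih]; ring

lemma bexp_nonneg {p : ℝ} (hp : p ∈ Set.Icc (0 : ℝ) 1) {Λ : Finset α} {f : Finset α → ℝ}
    (h : ∀ ω ⊆ Λ, 0 ≤ f ω) : 0 ≤ bexp p Λ f := by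
  rw [← bexp_const p Λ 0]; exact bexp_mono hp h

lemma bexp_inter (p : ℝ) (Λ A : Finset α) (f : Finset α → ℝ) :
    bexp p Λ (fun ω => f (ω ∩ A)) = bexp p (Λ ∩ A) f := by
  induction Λ using Finset.induction_on generalizing f with
  | empty => simp [bexp_empty]
  | insert v Λ hv ih =>
    rw [bexp_insert p hv, ih]
    by_cases hA : v ∈ A
    · have h1 : insert v Λ ∩ A = insert v (Λ ∩ A) := by grind
      rw [h1, bexp_insert p (by grind), ← ih fun ω => f (insert v ω)]
      congr 2
      exact bexp_congr p fun ω _ => by rw [Finset.insert_inter_of_mem hA]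
    · rw [Finset.insert_inter_of_notMem hA]
      have : bexp p Λ (fun ω => f (insert v ω ∩ A)) = bexp p Λ (fun ω => f (ω ∩ A)) :=
        bexp_congr p fun ω _ => by rw [Finset.insert_inter_of_notMem hA]
      rw [this, ih]; ring

/-- Functions of the configuration inside and outside `A` are independent. -/
lemma bexp_indep (p : ℝ) (Λ A : Finset α) (f g : Finset α → ℝ) :
    bexp p Λ (fun ω => f (ω ∩ A) * g (ω \ A))
      = bexp p Λ (fun ω => f (ω ∩ A)) * bexp p Λ (fun ω => g (ω \ A)) := by
  induction Λ using Finset.induction_on generalizing f g with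
  | empty => simp [bexp_empty]
  | insert v Λ hv ih =>
    rw [bexp_insert p hv, bexp_insert p hv, bexp_insert p hv]
    by_cases hA : v ∈ A
    · simp only [Finset.insert_inter_of_mem hA, Finset.insert_sdiff_of_mem _ hA]
      rw [ih, ih fun ω => f (insert v ω)]
      ring
    · simp only [Finset.insert_inter_of_notMem hA, Finset.insert_sdiff_of_notMem _ hA]
      rw [ih, ih _ fun ω => g (insert v ω)]
      ring

lemma bexp_eq_insert_erase (p : ℝ) {Λ : Finset α} {v : α} (hv : v ∈ Λ) (f : Finset α → ℝ) :
    bexp p Λ f = p * bexp p Λ (fun ω => f (insert v ω))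
      + (1 - p) * bexp p Λ (fun ω => f (ω.erase v)) := by
  rw [← Finset.insert_erase hv]
  have hv' : v ∉ Λ.erase v := Finset.notMem_erase v Λ
  simp only [bexp_insert p hv', Finset.insert_idem, Finset.erase_insert_eq_erase]
  have : bexp p (Λ.erase v) (fun ω => f (ω.erase v)) = bexp p (Λ.erase v) f :=
    bexp_congr p fun ω hω => by rw [Finset.erase_eq_of_notMem fun h => hv' (hω h)]
  rw [this]; ring

/-- The Harris–FKG inequality for two increasing functions. -/
lemma bexp_fkg {p : ℝ} (hp : p ∈ Set.Icc (0 : ℝ) 1) (Λ : Finset α) {f g : Finset α → ℝ}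
    (hf : Monotone f) (hg : Monotone g) :
    bexp p Λ f * bexp p Λ g ≤ bexp p Λ (fun ω => f ω * g ω) := by
  induction Λ using Finset.induction_on generalizing f g with
  | empty => simp [bexp_empty]
  | insert v Λ hv ih =>
    have hins : Monotone fun ω : Finset α => insert v ω := fun _ _ h =>
      Finset.insert_subset_insert v h
    rw [bexp_insert p hv, bexp_insert p hv, bexp_insert p hv]
    have h1 := ih hf hg
    have h2 := ih (hf.comp hins) (hg.comp hins)
    simp only [Function.comp_def] at h2
    have h3 : bexp p Λ f ≤ bexp p Λ (fun ω => f (insert v ω)) :=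
      bexp_mono hp fun ω _ => hf (Finset.subset_insert v ω)
    have h4 : bexp p Λ g ≤ bexp p Λ (fun ω => g (insert v ω)) :=
      bexp_mono hp fun ω _ => hg (Finset.subset_insert v ω)
    have hq : 0 ≤ 1 - p := by linarith [hp.2]
    have h5 := mul_le_mul_of_nonneg_left h1 hq
    have h6 := mul_le_mul_of_nonneg_left h2 hp.1
    have h7 := mul_nonneg (mul_nonneg hp.1 hq) (mul_nonneg (sub_nonneg.2 h3) (sub_nonneg.2 h4))
    nlinarith

/-- Russo's formula. -/
lemma hasDerivAt_bexp (p : ℝ) (Λ : Finset α) (f : Finset α → ℝ) :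
    HasDerivAt (fun q => bexp q Λ f)
      (∑ v ∈ Λ, bexp p Λ (fun ω => f (insert v ω) - f (ω.erase v))) p := by
  induction Λ using Finset.induction_on generalizing f with
  | empty =>
    simp only [bexp_empty, Finset.sum_empty]
    exact hasDerivAt_const p _
  | insert v Λ hv ih =>
    have h1 := (((hasDerivAt_id p).mul (ih fun ω => f (insert v ω))).add
      (((hasDerivAt_const p 1).sub (hasDerivAt_id p)).mul (ih f)))
    refine (h1.congr_deriv ?_).congr_of_eventuallyEq
      (Filter.Eventually.of_forall fun q => ?_)
    · rw [Finset.sum_insert hv]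
      have h2 : bexp p (insert v Λ) (fun ω => f (insert v ω) - f (ω.erase v))
          = bexp p Λ (fun ω => f (insert v ω)) - bexp p Λ f := by
        rw [bexp_insert p hv]
        simp only [Finset.insert_idem, Finset.erase_insert_eq_erase]
        have : bexp p Λ (fun ω => f (insert v ω) - f (ω.erase v))
            = bexp p Λ (fun ω => f (insert v ω)) - bexp p Λ f := by
          rw [← bexp_sub]
          exact bexp_congr p fun ω hω => by rw [Finset.erase_eq_of_notMem fun h => hv (hω h)]
        rw [this]; ring
      have h3 : ∀ u ∈ Λ, bexp p (insert v Λ) (fun ω => f (insert u ω) - f (ω.erase u))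
          = p * bexp p Λ (fun ω => f (insert v (insert u ω)) - f (insert v (ω.erase u)))
            + (1 - p) * bexp p Λ (fun ω => f (insert u ω) - f (ω.erase u)) := by
        intro u hu
        rw [bexp_insert p hv]
        congr 2
        refine bexp_congr p fun ω _ => ?_
        have huv : u ≠ v := fun h => hv (h ▸ hu)
        rw [Finset.insert_comm, Finset.erase_insert_of_ne huv.symm]
      rw [h2, Finset.sum_congr rfl h3, Finset.sum_add_distrib, ← Finset.mul_sum,
        ← Finset.mul_sum]
      simp only [id, Pi.sub_apply]
      ring
    · simp only [Pi.add_apply, Pi.mul_apply, Pi.sub_apply, id]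
      exact bexp_insert q hv f

lemma bexp_mono_param {p q : ℝ} (hp : 0 ≤ p) (hpq : p ≤ q) (hq : q ≤ 1) (Λ : Finset α)
    {f : Finset α → ℝ} (hf : Monotone f) : bexp p Λ f ≤ bexp q Λ f := by
  have hcont : ContinuousOn (fun r => bexp r Λ f) (Set.Icc 0 1) :=
    fun r _ => (hasDerivAt_bexp r Λ f).continuousAt.continuousWithinAt
  have hmono : MonotoneOn (fun r => bexp r Λ f) (Set.Icc 0 1) := by
    refine monotoneOn_of_deriv_nonneg (convex_Icc 0 1) hcont
      (fun r _ => (hasDerivAt_bexp r Λ f).differentiableAt.differentiableWithinAt) fun r hr => ?_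
    rw [(hasDerivAt_bexp r Λ f).deriv]
    refine Finset.sum_nonneg fun v _ => bexp_nonneg (interior_subset hr) fun ω _ =>
      sub_nonneg.2 (hf ?_)
    exact (Finset.erase_subset v ω).trans (Finset.subset_insert v ω)
  exact hmono ⟨hp, hpq.trans hq⟩ ⟨hp.trans hpq, hq⟩ hpq

lemma bexp_one_sub (p : ℝ) (Λ : Finset α) (f : Finset α → ℝ) :
    bexp (1 - p) Λ f = bexp p Λ (fun ω => f (Λ \ ω)) := by
  unfold bexp
  refine Finset.sum_nbij' (fun ω => Λ \ ω) (fun ω => Λ \ ω) ?_ ?_ ?_ ?_ ?_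
  · intro ω _; simp
  · intro ω _; simp
  · intro ω h; exact Finset.sdiff_sdiff_eq_self (Finset.mem_powerset.1 h)
  · intro ω h; exact Finset.sdiff_sdiff_eq_self (Finset.mem_powerset.1 h)
  · intro ω h
    have h' := Finset.sdiff_sdiff_eq_self (Finset.mem_powerset.1 h)
    simp only [sub_sub_cancel, h']
    ring

lemma bexp_map (p : ℝ) (e : α ↪ α) (Λ : Finset α) (f : Finset α → ℝ) :
    bexp p (Λ.map e) f = bexp p Λ (fun ω => f (ω.map e)) := by
  induction Λ using Finset.induction_on generalizing f with
  | empty => simp [bexp_empty]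
  | insert v Λ hv ih =>
    rw [Finset.map_insert, bexp_insert p (by simpa using hv), bexp_insert p hv, ih, ih]
    simp only [Finset.map_insert]

lemma bprob_mono {p : ℝ} (hp : p ∈ Set.Icc (0 : ℝ) 1) {Λ : Finset α} {A B : Finset α → Prop}
    (h : ∀ ω ⊆ Λ, A ω → B ω) : bprob p Λ A ≤ bprob p Λ B :=
  bexp_mono hp fun ω hω => ind_mono (h ω hω)

lemma bprob_nonneg {p : ℝ} (hp : p ∈ Set.Icc (0 : ℝ) 1) (Λ : Finset α) (A : Finset α → Prop) :
    0 ≤ bprob p Λ A := bexp_nonneg hp fun _ _ => ind_nonneg _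

lemma bprob_le_one {p : ℝ} (hp : p ∈ Set.Icc (0 : ℝ) 1) (Λ : Finset α) (A : Finset α → Prop) :
    bprob p Λ A ≤ 1 := by
  rw [← bexp_const p Λ 1]; exact bexp_mono hp fun _ _ => ind_le_one _

lemma bprob_not (p : ℝ) (Λ : Finset α) (A : Finset α → Prop) :
    bprob p Λ (fun ω => ¬ A ω) = 1 - bprob p Λ A := by
  unfold bprob
  simp only [ind_not, bexp_sub, bexp_const]

lemma bprob_or_le {p : ℝ} (hp : p ∈ Set.Icc (0 : ℝ) 1) (Λ : Finset α) (A B : Finset α → Prop) :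
    bprob p Λ (fun ω => A ω ∨ B ω) ≤ bprob p Λ A + bprob p Λ B := by
  unfold bprob
  rw [← bexp_add]
  exact bexp_mono hp fun ω _ => ind_or_le _ _

lemma bprob_exists_le {p : ℝ} (hp : p ∈ Set.Icc (0 : ℝ) 1) (Λ : Finset α) {β : Type*}
    (s : Finset β) (A : β → Finset α → Prop) :
    bprob p Λ (fun ω => ∃ x ∈ s, A x ω) ≤ ∑ x ∈ s, bprob p Λ (A x) := by
  unfold bprob
  rw [← bexp_sum]
  exact bexp_mono hp fun ω _ => ind_exists_le _ _

lemma ind_monotone {β : Type*} {A : Finset β → Prop} (hA : ∀ ω ω', ω ⊆ ω' → A ω → A ω') :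
    Monotone fun ω => ind (A ω) := fun ω₁ ω₂ h => ind_mono (hA ω₁ ω₂ h)

/-- Two decreasing events are positively correlated. -/
lemma bprob_not_mul_not_le {p : ℝ} (hp : p ∈ Set.Icc (0 : ℝ) 1) (Λ : Finset α)
    {A B : Finset α → Prop} (hA : ∀ ω ω', ω ⊆ ω' → A ω → A ω')
    (hB : ∀ ω ω', ω ⊆ ω' → B ω → B ω') :
    (1 - bprob p Λ A) * (1 - bprob p Λ B) ≤ 1 - bprob p Λ (fun ω => A ω ∨ B ω) := by
  have h := bexp_fkg hp Λ (ind_monotone hA) (ind_monotone hB)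
  have h2 : bprob p Λ (fun ω => A ω ∨ B ω)
      = bprob p Λ A + bprob p Λ B - bexp p Λ (fun ω => ind (A ω) * ind (B ω)) := by
    unfold bprob
    rw [← bexp_add, ← bexp_sub]
    refine bexp_congr p fun ω _ => ?_
    by_cases h1 : A ω <;> by_cases h2 : B ω <;> simp [ind, h1, h2]
  rw [h2]
  unfold bprob
  linarith

/-- An event depending only on the sites of `A ⊆ Λ` can be evaluated in `A`. -/
lemma bprob_local (p : ℝ) {Λ A : Finset α} (hA : A ⊆ Λ) {E F : Finset α → Prop}
    (h : ∀ ω ⊆ Λ, (E ω ↔ F (ω ∩ A))) : bprob p Λ E = bprob p A F := by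
  unfold bprob
  rw [bexp_congr p fun ω hω => ind_congr (h ω hω), bexp_inter p Λ A fun ω => ind (F ω),
    Finset.inter_eq_right.2 hA]

lemma bprob_indep (p : ℝ) (Λ A : Finset α) {E F : Finset α → Prop}
    (hE : ∀ ω ⊆ Λ, (E ω ↔ E (ω ∩ A))) (hF : ∀ ω ⊆ Λ, (F ω ↔ F (ω \ A))) :
    bprob p Λ (fun ω => E ω ∧ F ω) = bprob p Λ E * bprob p Λ F := by
  have h := bexp_indep p Λ A (fun ω => ind (E ω)) (fun ω => ind (F ω))
  unfold bprob
  rw [bexp_congr p fun ω hω => ind_congr (hE ω hω), bexp_congr p fun ω hω => ind_congr (hF ω hω),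
    ← h]
  exact bexp_congr p fun ω hω => by rw [ind_and, ind_congr (hE ω hω), ind_congr (hF ω hω)]

/-- The total influence of the sites of `B` dominates the effect of switching all of `B`. -/
lemma bexp_switch_le {p c : ℝ} (hp : p ∈ Set.Icc (0 : ℝ) 1) (hc : 0 ≤ c) (hcp : c ≤ p)
    (hcq : c ≤ 1 - p) (Λ : Finset α) {f : Finset α → ℝ} (hf : Antitone f)
    (B : Finset α) (hB : B ⊆ Λ) :
    c ^ B.card * bexp p Λ (fun ω => f (ω \ B) - f (ω ∪ B))
      ≤ ∑ v ∈ B, bexp p Λ (fun ω => f (ω.erase v) - f (insert v ω)) := by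
  have hc1 : c ≤ 1 := hcp.trans hp.2
  have hopen : ∀ (B : Finset α), B ⊆ Λ → ∀ h : Finset α → ℝ, (∀ ω, 0 ≤ h ω) →
      c ^ B.card * bexp p Λ (fun ω => h (ω ∪ B)) ≤ bexp p Λ h := by
    intro B
    induction B using Finset.induction_on with
    | empty => intro _ h _; simp
    | insert v B hv ih =>
      intro hB h hh
      have hvΛ : v ∈ Λ := hB (Finset.mem_insert_self v B)
      have h1 := ih ((Finset.subset_insert v B).trans hB) (fun ω => h (insert v ω)) fun ω => hh _
      have h2 : ∀ ω : Finset α, ω ∪ insert v B = insert v (ω ∪ B) := fun ω =>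
        Finset.union_insert v ω B
      simp only [h2]
      rw [Finset.card_insert_of_notMem hv, pow_succ]
      have h3 : 0 ≤ bexp p Λ (fun ω => h (insert v ω)) := bexp_nonneg hp fun ω _ => hh _
      have h4 : 0 ≤ bexp p Λ (fun ω => h (ω.erase v)) := bexp_nonneg hp fun ω _ => hh _
      have h5 := bexp_eq_insert_erase p hvΛ h
      rw [h5]
      have h6 := mul_le_mul_of_nonneg_left h1 hc
      have h7 := mul_le_mul_of_nonneg_right hcp h3
      have h8 := mul_nonneg (sub_nonneg.2 hp.2) h4
      linarith
  induction B using Finset.induction_on with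
  | empty => simp [bexp_const]
  | insert v B hv ih =>
    have hvΛ : v ∈ Λ := hB (Finset.mem_insert_self v B)
    have hBΛ : B ⊆ Λ := (Finset.subset_insert v B).trans hB
    have h1 := ih hBΛ
    have hfB : ∀ ω, 0 ≤ f (ω \ B) - f (ω ∪ B) := fun ω =>
      sub_nonneg.2 (hf (Finset.sdiff_subset.trans Finset.subset_union_left))
    have hfv : ∀ ω, 0 ≤ f (ω.erase v) - f (insert v ω) := fun ω =>
      sub_nonneg.2 (hf ((Finset.erase_subset v ω).trans (Finset.subset_insert v ω)))
    have h2 := bexp_eq_insert_erase p hvΛ fun ω => f (ω \ B) - f (ω ∪ B)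
    have h3 := hopen B hBΛ _ hfv
    have h4 : bexp p Λ (fun ω => f (ω \ insert v B) - f (ω ∪ insert v B))
        = bexp p Λ (fun ω => f (ω.erase v \ B) - f (ω.erase v ∪ B))
          + bexp p Λ (fun ω => f ((ω ∪ B).erase v) - f (insert v (ω ∪ B))) := by
      rw [← bexp_add]
      refine bexp_congr p fun ω _ => ?_
      have e1 : ω \ insert v B = ω.erase v \ B := by
        rw [Finset.erase_sdiff_comm, ← Finset.sdiff_insert]
      have e2 : ω ∪ insert v B = insert v (ω ∪ B) := Finset.union_insert v ω B
      have e3 : (ω ∪ B).erase v = ω.erase v ∪ B := by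
        rw [Finset.erase_union_distrib, Finset.erase_eq_of_notMem hv]
      rw [e1, e2, e3]; ring
    rw [Finset.sum_insert hv, Finset.card_insert_of_notMem hv, h4]
    have h5 : 0 ≤ bexp p Λ (fun ω => f (ω.erase v \ B) - f (ω.erase v ∪ B)) :=
      bexp_nonneg hp fun ω _ => hfB _
    have h6 : 0 ≤ bexp p Λ (fun ω => f (insert v ω \ B) - f (insert v ω ∪ B)) :=
      bexp_nonneg hp fun ω _ => hfB _
    have h7 : 0 ≤ bexp p Λ (fun ω => f ((ω ∪ B).erase v) - f (insert v (ω ∪ B))) :=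
      bexp_nonneg hp fun ω _ => hfv _
    set x := bexp p Λ (fun ω => f (ω.erase v \ B) - f (ω.erase v ∪ B))
    set y := bexp p Λ (fun ω => f ((ω ∪ B).erase v) - f (insert v (ω ∪ B)))
    set z := bexp p Λ (fun ω => f (ω \ B) - f (ω ∪ B))
    have hk : 0 ≤ c ^ B.card := pow_nonneg hc _
    have h8 : c * x ≤ z := by
      have h10 := mul_nonneg hp.1 h6
      have h11 := mul_le_mul_of_nonneg_right hcq h5
      linarith
    have h9 : c * (c ^ B.card * y) ≤ c ^ B.card * y :=
      mul_le_of_le_one_left (mul_nonneg hk h7) hc1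
    have h10 := mul_le_mul_of_nonneg_left h8 hk
    calc c ^ (B.card + 1) * (x + y) = c ^ B.card * (c * x) + c * (c ^ B.card * y) := by ring
      _ ≤ _ := by linarith

end Bernoulli

lemma triAdj_iff (u v : Site) : triAdj u v ↔
    (u.1 = v.1 + 1 ∧ u.2 = v.2) ∨ (u.1 = v.1 - 1 ∧ u.2 = v.2) ∨
    (u.1 = v.1 ∧ u.2 = v.2 + 1) ∨ (u.1 = v.1 ∧ u.2 = v.2 - 1) ∨
    (u.1 = v.1 + 1 ∧ u.2 = v.2 + 1) ∨ (u.1 = v.1 - 1 ∧ u.2 = v.2 - 1) := by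
  simp only [triAdj, Set.mem_insert_iff, Set.mem_singleton_iff, Prod.ext_iff, Prod.fst_sub,
    Prod.snd_sub]
  omega

lemma triAdj_symm {u v : Site} (h : triAdj u v) : triAdj v u := by
  rw [triAdj_iff] at h ⊢; omega

/-- `Conn O u v`: the sites `u` and `v` are joined by a path in `O`. -/
inductive Conn (O : Set Site) (u : Site) : Site → Prop
  | refl (h : u ∈ O) : Conn O u u
  | step {v w : Site} (h : Conn O u v) (hvw : triAdj v w) (hw : w ∈ O) : Conn O u w

namespace Conn

variable {O O' : Set Site} {u v w : Site}

lemma left_mem (h : Conn O u v) : u ∈ O := by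
  induction h with
  | refl h => exact h
  | step _ _ _ ih => exact ih

lemma right_mem (h : Conn O u v) : v ∈ O := by
  cases h with
  | refl h => exact h
  | step _ _ h => exact h

lemma trans (h : Conn O u v) (h' : Conn O v w) : Conn O u w := by
  induction h' with
  | refl _ => exact h
  | step _ hvw hw ih => exact ih.step hvw hw

lemma symm (h : Conn O u v) : Conn O v u := by
  induction h with
  | refl h => exact refl h
  | step h hvw hw ih => exact ((refl hw).step (triAdj_symm hvw) h.right_mem).trans ih

lemma mono (hO : O ⊆ O') (h : Conn O u v) : Conn O' u v := by
  induction h with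
  | refl h => exact refl (hO h)
  | step _ hvw hw ih => exact ih.step hvw (hO hw)

/-- A path all of whose initial segments end in a set is a path in that set. -/
lemma restrict (h : Conn O u v) (hO' : ∀ w, Conn O u w → w ∈ O') : Conn O' u v := by
  induction h with
  | refl h => exact refl (hO' _ (refl h))
  | step h hvw hw ih => exact ih.step hvw (hO' _ (h.step hvw hw))

lemma inter_of_left (h : Conn O u v) (hmem : ∀ w, Conn O u w → w ∈ O') :
    Conn (O ∩ O') u v :=
  h.restrict fun w hw => ⟨hw.right_mem, hmem w hw⟩

/-- Along a path from a site satisfying `P` to one not satisfying it, there is a first step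
leaving `P`. -/
lemma exists_exit (P : Site → Prop) (h : Conn O u v) (hu : P u) (hv : ¬ P v) :
    ∃ a b, Conn (O ∩ {x | P x}) u a ∧ triAdj a b ∧ b ∈ O ∧ ¬ P b := by
  have key : ∀ x, Conn O u x → Conn (O ∩ {x | P x}) u x ∨
      ∃ a b, Conn (O ∩ {x | P x}) u a ∧ triAdj a b ∧ b ∈ O ∧ ¬ P b := by
    intro x hx
    induction hx with
    | refl h => exact Or.inl (refl ⟨h, hu⟩)
    | @step y z h hvw hw ih =>
      rcases ih with ih | ih
      · by_cases hz : P z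
        · exact Or.inl (ih.step hvw ⟨hw, hz⟩)
        · exact Or.inr ⟨y, z, ih, hvw, hw, hz⟩
      · exact Or.inr ih
  rcases key v h with h' | h'
  · exact absurd h'.right_mem.2 hv
  · exact h'

lemma exists_path (h : Conn O u v) : ∃ (k : ℕ) (γ : ℕ → Site), γ 0 = u ∧ γ k = v ∧
    (∀ i ≤ k, γ i ∈ O) ∧ ∀ i < k, triAdj (γ i) (γ (i + 1)) := by
  induction h with
  | refl h => exact ⟨0, fun _ => u, rfl, rfl, fun _ _ => h, fun _ h => absurd h (Nat.not_lt_zero _)⟩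
  | @step y z h hvw hw ih =>
    obtain ⟨k, γ, h0, hk, hO, hadj⟩ := ih
    refine ⟨k + 1, fun i => if i ≤ k then γ i else z, by simpa using h0, by simp, ?_, ?_⟩
    · intro i _
      simp only
      split_ifs with h1
      · exact hO i h1
      · exact hw
    · intro i hi
      have h1 : i ≤ k := by omega
      simp only [h1, if_true]
      split_ifs with h2
      · exact hadj i h2
      · have : i = k := by omega
        rw [this, hk]; exact hvw

lemma map (e : Site → Site) (he : ∀ a b, triAdj a b → triAdj (e a) (e b)) (h : Conn O u v) :
    Conn (e '' O) (e u) (e v) := by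
  induction h with
  | refl h => exact refl (Set.mem_image_of_mem e h)
  | step _ hvw hw ih => exact ih.step (he _ _ hvw) (Set.mem_image_of_mem e hw)

end Conn

lemma sum_range_add_succ_zmod_two (g : ℕ → ZMod 2) (k : ℕ) :
    ∑ i ∈ Finset.range k, (g i + g (i + 1)) = g 0 + g k := by
  induction k with
  | zero => simp [CharTwo.add_self_eq_zero]
  | succ k ih =>
    rw [Finset.sum_range_succ, ih]
    have := CharTwo.add_self_eq_zero (g k)
    linear_combination this

section Crossing

/-- The step from `s` to `t` crosses, between the columns of `z` and its right neighbour, the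
vertical half-line above `z`. -/
noncomputable def crosses (z s t : Site) : ZMod 2 := open Classical in
  if (s.1 = z.1 ∧ t.1 = z.1 + 1 ∧ z.2 < s.2) ∨ (t.1 = z.1 ∧ s.1 = z.1 + 1 ∧ z.2 < t.2)
    then 1 else 0

/-- The indicator of the half-column strictly above `z`. -/
noncomputable def above (z s : Site) : ZMod 2 := open Classical in
  if s.1 = z.1 ∧ z.2 < s.2 then 1 else 0

lemma crosses_up {z s t : Site} (hs : s ≠ (z.1, z.2 + 1))
    (ht : t ≠ (z.1, z.2 + 1)) : crosses (z.1, z.2 + 1) s t = crosses z s t := by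
  simp only [ne_eq, Prod.ext_iff] at hs ht
  unfold crosses
  congr 1
  simp only [eq_iff_iff]
  omega

lemma crosses_right {z z' s t : Site} (hst : triAdj s t) (hz1 : z'.1 = z.1 + 1)
    (hz2 : z'.2 = z.2 ∨ z'.2 = z.2 + 1) (hs : s ≠ z) (ht : t ≠ z) (hs' : s ≠ z') (ht' : t ≠ z') :
    crosses z s t + crosses z' s t = above z' s + above z' t := by
  rw [triAdj_iff] at hst
  obtain ⟨s1, s2⟩ := s
  obtain ⟨t1, t2⟩ := t
  obtain ⟨z1, z2⟩ := z
  obtain ⟨w1, w2⟩ := z'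
  simp only [ne_eq, Prod.ext_iff] at *
  subst hz1
  unfold crosses above
  rcases hst with ⟨rfl, rfl⟩ | ⟨rfl, rfl⟩ | ⟨rfl, rfl⟩ | ⟨rfl, rfl⟩ | ⟨rfl, rfl⟩ | ⟨rfl, rfl⟩ <;>
    rcases hz2 with rfl | rfl <;> split_ifs <;> first | rfl | (exfalso; omega)

/-- The parity of the number of crossings of the half-line above `z` by the path `γ`. -/
noncomputable def windParity (γ : ℕ → Site) (k : ℕ) (z : Site) : ZMod 2 :=
  ∑ i ∈ Finset.range k, crosses z (γ i) (γ (i + 1))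

lemma windParity_eq_of_triAdj {γ : ℕ → Site} {k : ℕ} (hγ : ∀ i < k, triAdj (γ i) (γ (i + 1)))
    {z z' : Site} (hz : ∀ i ≤ k, γ i ≠ z) (hz' : ∀ i ≤ k, γ i ≠ z') (hzz : triAdj z z')
    (h0' : (γ 0).1 ≤ z.1 ∧ (γ 0).1 ≤ z'.1) (hk : z.1 < (γ k).1 ∧ z'.1 < (γ k).1) :
    windParity γ k z = windParity γ k z' := by
  have right : ∀ {z z' : Site}, (∀ i ≤ k, γ i ≠ z) → (∀ i ≤ k, γ i ≠ z') → z'.1 = z.1 + 1 →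
      (z'.2 = z.2 ∨ z'.2 = z.2 + 1) → (γ 0).1 < z'.1 → z'.1 < (γ k).1 →
      windParity γ k z = windParity γ k z' := by
    intro z z' hz hz' h1 h2 h3 h4
    have key : windParity γ k z + windParity γ k z' = 0 := by
      unfold windParity
      rw [← Finset.sum_add_distrib, Finset.sum_congr rfl fun i hi => crosses_right
        (hγ i (Finset.mem_range.1 hi)) h1 h2 (hz i (Finset.mem_range.1 hi).le)
        (hz _ (Finset.mem_range.1 hi)) (hz' i (Finset.mem_range.1 hi).le)
        (hz' _ (Finset.mem_range.1 hi)), sum_range_add_succ_zmod_two fun i => above z' (γ i)]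
      have e1 : above z' (γ 0) = 0 := if_neg fun h => by omega
      have e2 : above z' (γ k) = 0 := if_neg fun h => by omega
      rw [e1, e2, add_zero]
    exact CharTwo.add_eq_zero.1 key
  have up : ∀ {z z' : Site}, (∀ i ≤ k, γ i ≠ z') → z'.1 = z.1 → z'.2 = z.2 + 1 →
      windParity γ k z' = windParity γ k z := by
    intro z z' hz' h1 h2
    have : z' = (z.1, z.2 + 1) := Prod.ext h1 h2
    subst this
    exact Finset.sum_congr rfl fun i hi => crosses_up
      (hz' i (Finset.mem_range.1 hi).le) (hz' _ (Finset.mem_range.1 hi))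
  rw [triAdj_iff] at hzz
  rcases hzz with h | h | h | h | h | h
  · exact (right hz' hz h.1 (Or.inl h.2) (by omega) (by omega)).symm
  · exact right hz hz' (by omega) (Or.inl h.2.symm) (by omega) (by omega)
  · exact up hz h.1 h.2
  · exact (up hz' h.1.symm (by omega)).symm
  · exact (right hz' hz h.1 (Or.inr h.2) (by omega) (by omega)).symm
  · exact right hz hz' (by omega) (Or.inr (by omega)) (by omega) (by omega)

/-- In a parallelogram, a left–right path and a bottom–top path share a site. -/
theorem not_disjoint_crossings {l r b t : ℤ} {O C : Set Site} (hOC : Disjoint O C)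
    (hO : ∀ v ∈ O, b ≤ v.2 ∧ v.2 ≤ t)
    (hC : ∀ v ∈ C, l ≤ v.1 ∧ v.1 ≤ r) {u v w z : Site} (huv : Conn O u v)
    (hwz : Conn C w z) (hu : u.1 = l) (hv : v.1 = r) (hw : w.2 = b) (hz : z.2 = t) : False := by
  set e : Site := (r + 1, v.2) with he
  have huv' : Conn (O ∪ {e}) u e := (huv.mono Set.subset_union_left).step
    (by rw [triAdj_iff]; right; left; simp [he, hv]) (by simp)
  obtain ⟨k, γ, h0, hk, hγO, hγ⟩ := huv'.exists_path
  have hoff : ∀ x ∈ C, ∀ i ≤ k, γ i ≠ x := by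
    rintro x hx i hi rfl
    rcases hγO i hi with h | h
    · exact hOC.le_bot ⟨h, hx⟩
    · have := (hC _ hx).2
      rw [Set.mem_singleton_iff.1 h] at this
      simp [he] at this
  have hrow : ∀ i ≤ k, b ≤ (γ i).2 ∧ (γ i).2 ≤ t := by
    intro i hi
    rcases hγO i hi with h | h
    · exact hO _ h
    · rw [Set.mem_singleton_iff.1 h]; exact hO v huv.right_mem
  have hk1 : (γ k).1 = r + 1 := by rw [hk]
  have h01 : (γ 0).1 = l := by rw [h0, hu]
  have hconst : ∀ x, Conn C w x → windParity γ k x = windParity γ k w := by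
    intro x hx
    induction hx with
    | refl _ => rfl
    | @step a c h hac hc ih =>
      rw [← ih]
      have ha := hC a h.right_mem
      have hc' := hC c hc
      refine (windParity_eq_of_triAdj hγ (hoff a h.right_mem) (hoff c hc) hac ?_ ?_).symm
      · omega
      · omega
  have htop : windParity γ k z = 0 := Finset.sum_eq_zero fun i hi => if_neg fun h => by
    have h1 := hrow i (Finset.mem_range.1 hi).le
    have h2 := hrow (i + 1) (Finset.mem_range.1 hi)
    omega
  have hwC := hC w hwz.left_mem
  have hbot : windParity γ k w = 1 := by
    classical
    let g : ℕ → ZMod 2 := fun i => if w.1 < (γ i).1 then 1 else 0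
    have hstep : ∀ i ∈ Finset.range k, crosses w (γ i) (γ (i + 1)) = g i + g (i + 1) := by
      intro i hi
      have hi' := Finset.mem_range.1 hi
      have h1 := hrow i hi'.le
      have h2 := hrow (i + 1) hi'
      have h3 := hoff w hwz.left_mem i hi'.le
      have h4 := hoff w hwz.left_mem (i + 1) hi'
      have h5 := (triAdj_iff _ _).1 (hγ i hi')
      simp only [ne_eq, Prod.ext_iff] at h3 h4
      simp only [crosses, g]
      split_ifs <;> first | rfl | (exfalso; omega)
    unfold windParity
    rw [Finset.sum_congr rfl hstep, sum_range_add_succ_zmod_two g]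
    have e1 : g 0 = 0 := if_neg (by omega)
    have e2 : g k = 1 := if_pos (by omega)
    rw [e1, e2, zero_add]
  have := hconst z hwz
  rw [htop, hbot] at this
  exact zero_ne_one this

/-- In every two-colouring of `[0, n]²` there is a left–right path of the first colour or a
bottom–top path of the second. -/
theorem exists_crossing (n : ℕ) (O : Set Site) :
    (∃ u v, Conn (O ∩ box n) u v ∧ u.1 = 0 ∧ v.1 = n) ∨
      ∃ u v, Conn (Oᶜ ∩ box n) u v ∧ u.2 = 0 ∧ v.2 = n := by
  classical
  by_contra hcon
  push Not at hcon
  obtain ⟨hA, hD⟩ := hcon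
  let A : Site → Prop := fun v => ∃ u, Conn (O ∩ box n) u v ∧ u.1 = 0
  let D : Site → Prop := fun v => ∃ u, Conn (Oᶜ ∩ box n) u v ∧ u.2 = 0
  let a : Site → ZMod 2 := fun v => if A v then 1 else 0
  let d : Site → ZMod 2 := fun v => if D v then 1 else 0
  let e : Site → Site → ZMod 2 := fun u v => a u * d v + d u * a v
  have a_zero : ∀ v, v ∉ O → a v = 0 := fun v hv => if_neg fun ⟨_, h, _⟩ => hv h.right_mem.1
  have d_zero : ∀ v, v ∈ O → d v = 0 := fun v hv => if_neg fun ⟨_, h, _⟩ => h.right_mem.1 hv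
  have a_eq : ∀ u v, u ∈ box n → v ∈ box n → triAdj u v → u ∈ O → v ∈ O → a u = a v := by
    intro u v hu hv huv huO hvO
    have : A u ↔ A v := ⟨fun ⟨w, h, h'⟩ => ⟨w, h.step huv ⟨hvO, hv⟩, h'⟩,
      fun ⟨w, h, h'⟩ => ⟨w, h.step (triAdj_symm huv) ⟨huO, hu⟩, h'⟩⟩
    simp only [a, this]
  have d_eq : ∀ u v, u ∈ box n → v ∈ box n → triAdj u v → u ∉ O → v ∉ O → d u = d v := by
    intro u v hu hv huv huO hvO
    have : D u ↔ D v := ⟨fun ⟨w, h, h'⟩ => ⟨w, h.step huv ⟨hvO, hv⟩, h'⟩,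
      fun ⟨w, h, h'⟩ => ⟨w, h.step (triAdj_symm huv) ⟨huO, hu⟩, h'⟩⟩
    simp only [d, this]
  have triangle : ∀ x y z, x ∈ box n → y ∈ box n → z ∈ box n → triAdj x y → triAdj y z →
      triAdj x z → e x y + e y z = e x z := by
    intro x y z hx hy hz hxy hyz hxz
    simp only [e]
    by_cases h1 : x ∈ O <;> by_cases h2 : y ∈ O <;> by_cases h3 : z ∈ O
    · simp [d_zero _ h1, d_zero _ h2, d_zero _ h3]
    · simp [d_zero _ h1, d_zero _ h2, a_zero _ h3, a_eq x y hx hy hxy h1 h2]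
    · have := CharTwo.add_self_eq_zero (a x * d y)
      simp [d_zero _ h1, a_zero _ h2, d_zero _ h3, ← a_eq x z hx hz hxz h1 h3]
      linear_combination this
    · simp [d_zero _ h1, a_zero _ h2, a_zero _ h3, d_eq y z hy hz hyz h2 h3]
    · simp [a_zero _ h1, d_zero _ h2, d_zero _ h3, a_eq y z hy hz hyz h2 h3]
    · have := CharTwo.add_self_eq_zero (d x * a y)
      simp [a_zero _ h1, d_zero _ h2, a_zero _ h3, ← d_eq x z hx hz hxz h1 h3]
      linear_combination this
    · simp [a_zero _ h1, a_zero _ h2, d_zero _ h3, d_eq x y hx hy hxy h1 h2]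
    · simp [a_zero _ h1, a_zero _ h2, a_zero _ h3]
  let s : ℕ → ℕ → Site := fun i j => ((i : ℤ), (j : ℤ))
  have s_mem : ∀ i j, i ≤ n → j ≤ n → s i j ∈ box n := by
    intro i j hi hj; simp only [box, s, Set.mem_ofPred_eq]; omega
  have adjH : ∀ i j, triAdj (s i j) (s (i + 1) j) := by
    intro i j; rw [triAdj_iff]; simp [s]
  have adjV : ∀ i j, triAdj (s i j) (s i (j + 1)) := by
    intro i j; rw [triAdj_iff]; simp [s]
  have adjD : ∀ i j, triAdj (s i j) (s (i + 1) (j + 1)) := by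
    intro i j; rw [triAdj_iff]; simp [s]
  let H : ℕ → ℕ → ZMod 2 := fun i j => e (s i j) (s (i + 1) j)
  let V : ℕ → ℕ → ZMod 2 := fun i j => e (s i j) (s i (j + 1))
  have cell : ∀ i < n, ∀ j < n, (H i j + H i (j + 1)) + (V i j + V (i + 1) j) = 0 := by
    intro i hi j hj
    have h1 := triangle _ _ _ (s_mem i j hi.le hj.le) (s_mem (i + 1) j hi hj.le)
      (s_mem (i + 1) (j + 1) hi hj) (adjH i j) (adjV (i + 1) j) (adjD i j)
    have h2 := triangle _ _ _ (s_mem i j hi.le hj.le) (s_mem i (j + 1) hi.le hj)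
      (s_mem (i + 1) (j + 1) hi hj) (adjV i j) (adjH i (j + 1)) (adjD i j)
    have h3 := CharTwo.add_self_eq_zero (e (s i j) (s (i + 1) (j + 1)))
    simp only [H, V]
    linear_combination h1 + h2 + h3
  have total : ∑ i ∈ Finset.range n, (H i 0 + H i n) + ∑ j ∈ Finset.range n, (V 0 j + V n j)
      = 0 := by
    have h1 : ∑ i ∈ Finset.range n, (H i 0 + H i n)
        = ∑ i ∈ Finset.range n, ∑ j ∈ Finset.range n, (H i j + H i (j + 1)) :=
      Finset.sum_congr rfl fun i _ => (sum_range_add_succ_zmod_two (H i) n).symm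
    have h2 : ∑ j ∈ Finset.range n, (V 0 j + V n j)
        = ∑ j ∈ Finset.range n, ∑ i ∈ Finset.range n, (V i j + V (i + 1) j) :=
      Finset.sum_congr rfl fun j _ => (sum_range_add_succ_zmod_two (fun i => V i j) n).symm
    rw [h1, h2, Finset.sum_comm (s := Finset.range n) (t := Finset.range n)
      (f := fun j i => V i j + V (i + 1) j), ← Finset.sum_add_distrib]
    refine Finset.sum_eq_zero fun i hi => ?_
    rw [← Finset.sum_add_distrib]
    exact Finset.sum_eq_zero fun j hj => cell i (Finset.mem_range.1 hi) j (Finset.mem_range.1 hj)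
  have a_left : ∀ j ≤ n, s 0 j ∈ O → a (s 0 j) = 1 := fun j hj h =>
    if_pos ⟨s 0 j, Conn.refl ⟨h, s_mem 0 j (Nat.zero_le n) hj⟩, by simp [s]⟩
  have d_bot : ∀ i ≤ n, s i 0 ∉ O → d (s i 0) = 1 := fun i hi h =>
    if_pos ⟨s i 0, Conn.refl ⟨h, s_mem i 0 hi (Nat.zero_le n)⟩, by simp [s]⟩
  have a_right : ∀ j, a (s n j) = 0 := fun j => if_neg fun ⟨u, h, h'⟩ => hA u _ h h' (by simp [s])
  have d_top : ∀ i, d (s i n) = 0 := fun i => if_neg fun ⟨u, h, h'⟩ => hD u _ h h' (by simp [s])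
  have top : ∀ i, H i n = 0 := fun i => by simp only [H, e, d_top]; ring
  have right : ∀ j, V n j = 0 := fun j => by simp only [V, e, a_right]; ring
  have left : ∀ j ∈ Finset.range n, V 0 j = d (s 0 j) + d (s 0 (j + 1)) := by
    intro j hj
    have hj' := Finset.mem_range.1 hj
    have hm := s_mem 0 j (Nat.zero_le n) hj'.le
    have hm' := s_mem 0 (j + 1) (Nat.zero_le n) hj'
    simp only [V, e]
    by_cases h1 : s 0 j ∈ O <;> by_cases h2 : s 0 (j + 1) ∈ O
    · simp [d_zero _ h1, d_zero _ h2]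
    · simp [d_zero _ h1, a_zero _ h2, a_left j hj'.le h1]
    · simp [a_zero _ h1, d_zero _ h2, a_left (j + 1) hj' h2]
    · simp [a_zero _ h1, a_zero _ h2, d_eq _ _ hm hm' (adjV 0 j) h1 h2,
        CharTwo.add_self_eq_zero]
  have bot : ∀ i ∈ Finset.range n, H i 0 = a (s i 0) + a (s (i + 1) 0) := by
    intro i hi
    have hi' := Finset.mem_range.1 hi
    have hm := s_mem i 0 hi'.le (Nat.zero_le n)
    have hm' := s_mem (i + 1) 0 hi' (Nat.zero_le n)
    simp only [H, e]
    by_cases h1 : s i 0 ∈ O <;> by_cases h2 : s (i + 1) 0 ∈ O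
    · simp [d_zero _ h1, d_zero _ h2, a_eq _ _ hm hm' (adjH i 0) h1 h2,
        CharTwo.add_self_eq_zero]
    · simp [d_zero _ h1, a_zero _ h2, d_bot (i + 1) hi' h2]
    · simp [a_zero _ h1, d_zero _ h2, d_bot i hi'.le h1]
    · simp [a_zero _ h1, a_zero _ h2]
  simp only [top, right, add_zero] at total
  rw [Finset.sum_congr rfl left, Finset.sum_congr rfl bot,
    sum_range_add_succ_zmod_two fun i => a (s i 0),
    sum_range_add_succ_zmod_two fun j => d (s 0 j), a_right, d_top] at total
  by_cases h : s 0 0 ∈ O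
  · rw [a_left 0 (Nat.zero_le n) h, d_zero _ h] at total
    simp at total
  · rw [d_bot 0 (Nat.zero_le n) h, a_zero _ h] at total
    simp at total

end Crossing

section Boxes

/-- The ball `x + [-n, n]²`. -/
noncomputable def bx (x : Site) (n : ℕ) : Finset Site :=
  Finset.Icc (x.1 - n) (x.1 + n) ×ˢ Finset.Icc (x.2 - n) (x.2 + n)

lemma mem_bx {x v : Site} {n : ℕ} :
    v ∈ bx x n ↔ (x.1 - n ≤ v.1 ∧ v.1 ≤ x.1 + n) ∧ x.2 - n ≤ v.2 ∧ v.2 ≤ x.2 + n := by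
  simp [bx]

lemma bx_subset {x y : Site} {n m : ℕ} (h1 : |x.1 - y.1| + n ≤ m) (h2 : |x.2 - y.2| + n ≤ m) :
    bx x n ⊆ bx y m := by
  intro v hv
  rw [mem_bx] at hv ⊢
  have := le_abs_self (x.1 - y.1)
  have := neg_abs_le (x.1 - y.1)
  have := le_abs_self (x.2 - y.2)
  have := neg_abs_le (x.2 - y.2)
  omega

lemma self_mem_bx (x : Site) (n : ℕ) : x ∈ bx x n := by
  rw [mem_bx]; omega

lemma bx_map_addRight (x y : Site) (n : ℕ) :
    (bx x n).map (Equiv.addRight y).toEmbedding = bx (x + y) n := by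
  ext v
  simp only [Finset.mem_map_equiv, mem_bx, Equiv.addRight_symm, Equiv.coe_addRight, Prod.fst_add,
    Prod.snd_add, Prod.fst_neg, Prod.snd_neg]
  omega

lemma Conn.map_iff (e : Site ≃ Site) (he : ∀ a b, triAdj (e a) (e b) ↔ triAdj a b) {O : Set Site}
    {u v : Site} : Conn (e '' O) (e u) (e v) ↔ Conn O u v := by
  refine ⟨fun h => ?_, Conn.map e fun a b => (he a b).2⟩
  have := h.map e.symm fun a b hab => by
    rw [← he, e.apply_symm_apply, e.apply_symm_apply]; exact hab
  simpa [← Set.image_comp] using this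

lemma triAdj_addRight (y a b : Site) :
    triAdj (Equiv.addRight y a) (Equiv.addRight y b) ↔ triAdj a b := by
  simp [triAdj]

lemma triAdj_swap (a b : Site) :
    triAdj (Equiv.prodComm ℤ ℤ a) (Equiv.prodComm ℤ ℤ b) ↔ triAdj a b := by
  simp only [triAdj_iff, Equiv.prodComm_apply, Prod.fst_swap, Prod.snd_swap]
  omega

lemma triAdj_neg (a b : Site) : triAdj (Equiv.neg Site a) (Equiv.neg Site b) ↔ triAdj a b := by
  simp only [triAdj_iff, Equiv.neg_apply, Prod.fst_neg, Prod.snd_neg]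
  omega

lemma bx_zero_map_swap (n : ℕ) : (bx 0 n).map (Equiv.prodComm ℤ ℤ).toEmbedding = bx 0 n := by
  ext v
  simp only [Finset.mem_map_equiv, mem_bx, Equiv.prodComm_symm, Equiv.prodComm_apply,
    Prod.fst_swap, Prod.snd_swap, Prod.fst_zero, Prod.snd_zero]
  omega

lemma bx_zero_map_neg (n : ℕ) : (bx 0 n).map (Equiv.neg Site).toEmbedding = bx 0 n := by
  ext v
  simp only [Finset.mem_map_equiv, mem_bx, Equiv.neg_symm, Equiv.neg_apply,
    Prod.fst_neg, Prod.snd_neg, Prod.fst_zero, Prod.snd_zero]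
  omega

lemma bprob_map (p : ℝ) (e : Site ↪ Site) (Λ : Finset Site) (E : Finset Site → Prop) :
    bprob p (Λ.map e) E = bprob p Λ fun ω => E (ω.map e) := bexp_map p e Λ _

end Boxes

section Reach

/-- `v` is joined to the complement of `Λ` by a path in `O ∪ Λᶜ`. -/
def Reach (Λ : Finset Site) (O : Set Site) (v : Site) : Prop :=
  ∃ u ∉ Λ, Conn (O ∪ (Λ : Set Site)ᶜ) v u

lemma Reach.mono {Λ : Finset Site} {O O' : Set Site} {v : Site} (h : O ⊆ O') (hv : Reach Λ O v) :
    Reach Λ O' v := by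
  obtain ⟨u, hu, huv⟩ := hv
  exact ⟨u, hu, huv.mono (Set.union_subset_union_left _ h)⟩

lemma Reach.anti {Λ Λ' : Finset Site} {O : Set Site} {v : Site} (h : Λ ⊆ Λ')
    (hv : Reach Λ' O v) : Reach Λ O v := by
  obtain ⟨u, hu, huv⟩ := hv
  exact ⟨u, fun hu' => hu (h hu'), huv.mono (Set.union_subset_union_right _
    (Set.compl_subset_compl.2 (by exact_mod_cast h)))⟩

lemma reach_inter_iff {Λ : Finset Site} {ω : Finset Site} {v : Site} :
    Reach Λ ω v ↔ Reach Λ ((ω ∩ Λ : Finset Site) : Set Site) v := by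
  have : (ω : Set Site) ∪ (Λ : Set Site)ᶜ
      = ((ω ∩ Λ : Finset Site) : Set Site) ∪ (Λ : Set Site)ᶜ := by
    ext x; simp; tauto
  simp only [Reach, this]

lemma reach_map_iff (e : Site ≃ Site) (he : ∀ a b, triAdj (e a) (e b) ↔ triAdj a b)
    {Λ : Finset Site} {O : Set Site} {v : Site} :
    Reach (Λ.map e.toEmbedding) (e '' O) (e v) ↔ Reach Λ O v := by
  have : (e '' O) ∪ ((Λ.map e.toEmbedding : Finset Site) : Set Site)ᶜ
      = e '' (O ∪ (Λ : Set Site)ᶜ) := by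
    rw [Set.image_union, Set.image_compl_eq e.bijective, Finset.coe_map]; rfl
  unfold Reach
  rw [this]
  constructor
  · rintro ⟨u, hu, h⟩
    refine ⟨e.symm u, fun h' => hu (by simpa [Finset.mem_map_equiv] using h'), ?_⟩
    rw [← Conn.map_iff e he, e.apply_symm_apply]; exact h
  · rintro ⟨u, hu, h⟩
    exact ⟨e u, by simpa using hu, (Conn.map_iff e he).2 h⟩

/-- The probability that the origin is joined to the complement of its ball of radius `n`. -/
noncomputable def reachProb (p : ℝ) (n : ℕ) : ℝ := bprob p (bx 0 n) fun ω => Reach (bx 0 n) ω 0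

lemma bprob_reach_self (p : ℝ) {x : Site} {n : ℕ} {Λ : Finset Site} (h : bx x n ⊆ Λ) :
    bprob p Λ (fun ω => Reach (bx x n) ω x) = reachProb p n := by
  rw [bprob_local p h (F := fun ω => Reach (bx x n) ω x) fun ω _ => reach_inter_iff, reachProb]
  have h1 : bx x n = (bx 0 n).map (Equiv.addRight x).toEmbedding := by
    rw [bx_map_addRight, zero_add]
  rw [h1, bprob_map]
  refine bexp_congr p fun ω _ => ind_congr ?_
  have h2 := reach_map_iff (Equiv.addRight x) (triAdj_addRight x) (Λ := bx 0 n) (O := ω) (v := 0)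
  simp only [Finset.coe_map]
  simpa using h2

lemma bprob_reach_le {p : ℝ} (hp : p ∈ Set.Icc (0 : ℝ) 1) {x : Site} {n : ℕ} {Λ Λ' : Finset Site}
    (h : bx x n ⊆ Λ) (h' : bx x n ⊆ Λ') : bprob p Λ (fun ω => Reach Λ' ω x) ≤ reachProb p n := by
  rw [← bprob_reach_self p h]
  exact bprob_mono hp fun ω _ => Reach.anti h'

lemma reachProb_nonneg {p : ℝ} (hp : p ∈ Set.Icc (0 : ℝ) 1) (n : ℕ) : 0 ≤ reachProb p n :=
  bprob_nonneg hp _ _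

lemma reachProb_le_one {p : ℝ} (hp : p ∈ Set.Icc (0 : ℝ) 1) (n : ℕ) : reachProb p n ≤ 1 :=
  bprob_le_one hp _ _

end Reach

section Crossing

/-- A left–right crossing of `[0, n]²` in `O`. -/
def HCross (n : ℕ) (O : Set Site) : Prop :=
  ∃ u v, Conn (O ∩ box n) u v ∧ u.1 = 0 ∧ v.1 = n

/-- A bottom–top crossing of `[0, n]²` in `O`. -/
def VCross (n : ℕ) (O : Set Site) : Prop :=
  ∃ u v, Conn (O ∩ box n) u v ∧ u.2 = 0 ∧ v.2 = n

lemma hCross_swap_iff (n : ℕ) (O : Set Site) : HCross n (Equiv.prodComm ℤ ℤ '' O) ↔ VCross n O := by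
  have hbox : box n = Equiv.prodComm ℤ ℤ '' box n := by
    ext v
    simp only [Equiv.image_eq_preimage_symm, Set.mem_preimage, box, Set.mem_ofPred_eq,
      Equiv.prodComm_symm, Equiv.prodComm_apply, Prod.fst_swap, Prod.snd_swap]
    omega
  have himg : Equiv.prodComm ℤ ℤ '' O ∩ box n = Equiv.prodComm ℤ ℤ '' (O ∩ box n) := by
    rw [Set.image_inter (Equiv.prodComm ℤ ℤ).injective, ← hbox]
  unfold HCross VCross
  rw [himg]
  constructor
  · rintro ⟨u, v, h, hu, hv⟩
    refine ⟨u.swap, v.swap, ?_, hu, hv⟩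
    rw [← Conn.map_iff _ triAdj_swap]
    simpa using h
  · rintro ⟨u, v, h, hu, hv⟩
    exact ⟨u.swap, v.swap, (Conn.map_iff _ triAdj_swap).2 h, hu, hv⟩

lemma half_le_bprob_hCross (n : ℕ) {m : ℕ} (hnm : n ≤ m) :
    1 / 2 ≤ bprob (1 / 2) (bx 0 m) fun ω => HCross n ω := by
  have hp : (1 / 2 : ℝ) ∈ Set.Icc (0 : ℝ) 1 := by norm_num
  have hbox : box n ⊆ bx 0 m := by
    intro v hv
    simp only [box, Set.mem_ofPred_eq] at hv
    simp only [SetLike.mem_coe, mem_bx, Prod.fst_zero, Prod.snd_zero]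
    omega
  have h1 : (1 : ℝ) ≤ bprob (1 / 2) (bx 0 m) (fun ω => HCross n ω ∨ VCross n ((bx 0 m \ ω :
      Finset Site) : Set Site)) := by
    refine (bexp_const (1 / 2) (bx 0 m) 1).ge.trans (bexp_mono hp fun ω _ => (ind_true ?_).ge)
    refine (exists_crossing n ω).imp id fun ⟨u, v, h, hu, hv⟩ => ⟨u, v, h.mono ?_, hu, hv⟩
    rintro x ⟨hx, hx'⟩
    have : x ∈ bx 0 m \ ω := Finset.mem_sdiff.2 ⟨hbox hx', hx⟩
    exact ⟨this, hx'⟩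
  have h2 : bprob (1 / 2) (bx 0 m) (fun ω => VCross n ((bx 0 m \ ω : Finset Site) : Set Site))
      = bprob (1 / 2) (bx 0 m) fun ω => HCross n ω := by
    have e1 := bexp_one_sub (1 / 2) (bx 0 m) fun ω : Finset Site => ind (VCross n ω)
    have e2 := bprob_map (1 / 2) (Equiv.prodComm ℤ ℤ).toEmbedding (bx 0 m)
      (fun ω => HCross n ω)
    rw [bx_zero_map_swap] at e2
    rw [e2, bprob, ← e1]
    norm_num1
    refine bexp_congr _ fun ω _ => ind_congr ?_
    simp only [Finset.coe_map]
    exact (hCross_swap_iff n ω).symm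
  have h3 := bprob_or_le hp (bx 0 m) (fun ω => HCross n ω)
    (fun ω => VCross n ((bx 0 m \ ω : Finset Site) : Set Site))
  rw [h2] at h3
  linarith

lemma half_le_mul_reachProb (n : ℕ) : 1 / 2 ≤ (n + 2) * reachProb (1 / 2) n := by
  have hp : (1 / 2 : ℝ) ∈ Set.Icc (0 : ℝ) 1 := by norm_num
  refine (half_le_bprob_hCross (n + 1) (m := 3 * n + 3) (by omega)).trans ?_
  calc bprob (1 / 2) (bx 0 (3 * n + 3)) (fun ω => HCross (n + 1) ω)
      ≤ bprob (1 / 2) (bx 0 (3 * n + 3)) (fun ω => ∃ j ∈ Finset.range (n + 2),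
          Reach (bx (0, (j : ℤ)) n) ω (0, (j : ℤ))) := by
        refine bprob_mono hp fun ω _ => ?_
        rintro ⟨u, v, h, hu, hv⟩
        have hu' := h.left_mem.2
        simp only [box, Set.mem_ofPred_eq] at hu'
        push_cast at hv hu'
        refine ⟨u.2.toNat, Finset.mem_range.2 (by omega), v, ?_, ?_⟩
        · rw [mem_bx]; simp only; omega
        · have : ((0 : ℤ), (u.2.toNat : ℤ)) = u := Prod.ext hu.symm (by simp; omega)
          rw [this]
          exact h.mono fun x hx => Or.inl hx.1
    _ ≤ ∑ j ∈ Finset.range (n + 2), bprob (1 / 2) (bx 0 (3 * n + 3)) (fun ω =>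
          Reach (bx (0, (j : ℤ)) n) ω (0, (j : ℤ))) := bprob_exists_le hp _ _ _
    _ = ∑ j ∈ Finset.range (n + 2), reachProb (1 / 2) n := by
        refine Finset.sum_congr rfl fun j hj => bprob_reach_self _ ?_
        have := Finset.mem_range.1 hj
        intro v hv
        simp only [mem_bx, Prod.fst_zero, Prod.snd_zero] at hv ⊢
        push_cast
        omega
    _ = (n + 2) * reachProb (1 / 2) n := by simp

end Crossing

open Classical in
/-- The sites outside `S` adjacent to `S`. -/
noncomputable def outerBdry (S : Finset Site) : Finset Site :=
  (S.biUnion fun v => bx v 1).filter fun x => x ∉ S ∧ ∃ y ∈ S, triAdj x y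

lemma mem_bx_one {x y : Site} (h : triAdj x y) : x ∈ bx y 1 := by
  rw [triAdj_iff] at h
  rw [mem_bx]
  push_cast
  omega

lemma mem_outerBdry {S : Finset Site} {x : Site} :
    x ∈ outerBdry S ↔ x ∉ S ∧ ∃ y ∈ S, triAdj x y := by
  simp only [outerBdry, Finset.mem_filter, Finset.mem_biUnion, and_iff_right_iff_imp]
  rintro ⟨_, y, hy, h⟩
  exact ⟨y, hy, mem_bx_one h⟩

/-- The site `x` is adjacent to the cluster of the origin inside `S`. -/
def Link (S : Finset Site) (O : Set Site) (x : Site) : Prop :=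
  ∃ y, triAdj x y ∧ Conn (O ∩ S) 0 y

/-- The expected number of boundary sites of `S` adjacent to the cluster of the origin in `S`. -/
noncomputable def phi (p : ℝ) (S : Finset Site) : ℝ :=
  ∑ x ∈ outerBdry S, bprob p S fun ω => Link S ω x

open Classical in
/-- The cluster of the origin inside `S`. -/
noncomputable def cluster (S ω : Finset Site) : Finset Site :=
  S.filter fun v => Conn ((ω : Set Site) ∩ S) 0 v

open Classical in
/-- The set `C` together with its neighbours in `S`. -/
noncomputable def hull (S C : Finset Site) : Finset Site :=
  C ∪ S.filter fun x => ∃ y ∈ C, triAdj x y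

lemma mem_cluster {S ω : Finset Site} {v : Site} :
    v ∈ cluster S ω ↔ Conn ((ω : Set Site) ∩ S) 0 v := by
  simp only [cluster, Finset.mem_filter, and_iff_right_iff_imp]
  exact fun h => h.right_mem.2

lemma cluster_subset (S ω : Finset Site) : cluster S ω ⊆ S := by
  classical exact Finset.filter_subset _ _

lemma mem_hull {S C : Finset Site} {x : Site} :
    x ∈ hull S C ↔ x ∈ C ∨ x ∈ S ∧ ∃ y ∈ C, triAdj x y := by
  simp [hull]

lemma cluster_mono {S ω ω' : Finset Site} (h : ω ⊆ ω') : cluster S ω ⊆ cluster S ω' := by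
  intro v hv
  rw [mem_cluster] at hv ⊢
  exact hv.mono (Set.inter_subset_inter_left _ (by exact_mod_cast h))

lemma cluster_inter_hull {S ω C : Finset Site} (h0 : (0 : Site) ∈ C) :
    cluster S ω = C ↔ cluster S (ω ∩ hull S C) = C := by
  constructor
  · intro h
    refine (h ▸ cluster_mono Finset.inter_subset_left).antisymm fun v hv => ?_
    rw [← h, mem_cluster] at hv
    rw [mem_cluster]
    have h1 : ∀ w, Conn ((ω : Set Site) ∩ S) 0 w → w ∈ hull S C := fun w hw =>
      mem_hull.2 (Or.inl (h ▸ mem_cluster.2 hw))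
    refine (hv.inter_of_left (O' := {w | w ∈ hull S C}) h1).mono ?_
    rintro x ⟨⟨hx, hx'⟩, hx''⟩
    exact ⟨Finset.mem_coe.2 (Finset.mem_inter.2 ⟨hx, hx''⟩), hx'⟩
  · intro h
    refine Finset.Subset.antisymm (fun v hv => ?_) (h ▸ cluster_mono Finset.inter_subset_left)
    rw [mem_cluster] at hv
    induction hv with
    | refl _ => exact h0
    | @step y z _ hyz hz ih =>
      have hz' : z ∈ hull S C := mem_hull.2 (Or.inr ⟨hz.2, y, ih, triAdj_symm hyz⟩)
      rw [← h, mem_cluster] at ih ⊢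
      exact ih.step hyz ⟨Finset.mem_coe.2 (Finset.mem_inter.2 ⟨hz.1, hz'⟩), hz.2⟩

lemma Reach.exists_outerBdry {S Λ ω : Finset Site} (hS : S ⊆ Λ) (h0 : (0 : Site) ∈ S)
    (h : Reach Λ ω 0) : 0 ∈ cluster S ω ∧ ∃ x ∈ outerBdry S, (∃ y ∈ cluster S ω, triAdj x y) ∧
      Reach Λ ((ω \ hull S (cluster S ω) : Finset Site) : Set Site) x := by
  obtain ⟨u, hu, hcon⟩ := h
  have hmem : ∀ x ∈ (ω : Set Site) ∪ (Λ : Set Site)ᶜ, x ∈ S → x ∈ (ω : Set Site) ∩ S :=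
    fun x hx hxS => ⟨hx.resolve_right fun h => h (hS hxS), hxS⟩
  have h0C : 0 ∈ cluster S ω := mem_cluster.2 (Conn.refl (hmem 0 hcon.left_mem h0))
  refine ⟨h0C, ?_⟩
  obtain ⟨a, b, hua, hab, hb, hbC⟩ := hcon.symm.exists_exit (fun x => x ∉ cluster S ω)
    (fun h => hu (hS (cluster_subset _ _ h))) (not_not.2 h0C)
  rw [not_not] at hbC
  have haC := hua.right_mem
  have key : ∀ x ∈ (ω : Set Site) ∪ (Λ : Set Site)ᶜ, x ∈ hull S (cluster S ω) →
      x ∈ cluster S ω := by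
    intro x hx hxh
    rcases mem_hull.1 hxh with h | ⟨hxS, y, hy, hxy⟩
    · exact h
    · rw [mem_cluster] at hy ⊢
      exact hy.step (triAdj_symm hxy) (hmem x hx hxS)
  refine ⟨a, mem_outerBdry.2 ⟨fun haS => haC.2 (key a haC.1 (mem_hull.2
    (Or.inr ⟨haS, b, hbC, hab⟩))), b, cluster_subset _ _ hbC, hab⟩, ⟨b, hbC, hab⟩, u, hu,
    hua.symm.mono ?_⟩
  rintro x ⟨hx, hxC⟩
  rcases hx with hx' | hx'
  · exact Or.inl (Finset.mem_coe.2 (Finset.mem_sdiff.2 ⟨hx', fun h => hxC (key x (Or.inl hx') h)⟩))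
  · exact Or.inr hx'

lemma bprob_reach_le_phi_mul {p M : ℝ} (hp : p ∈ Set.Icc (0 : ℝ) 1) {S Λ : Finset Site}
    (hS : S ⊆ Λ) (h0 : (0 : Site) ∈ S)
    (hM : ∀ x ∈ outerBdry S, bprob p Λ (fun ω => Reach Λ ω x) ≤ M) :
    bprob p Λ (fun ω => Reach Λ ω 0) ≤ phi p S * M := by
  classical
  let Q : Finset Site → Site → Prop := fun C x => 0 ∈ C ∧ ∃ y ∈ C, triAdj x y
  let T : Site → Finset Site → Finset Site → Prop := fun x C ω =>
    cluster S ω = C ∧ Reach Λ ((ω \ hull S C : Finset Site) : Set Site) x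
  have step : ∀ x ∈ outerBdry S, ∀ C,
      bprob p Λ (fun ω => Q C x ∧ T x C ω) ≤ bprob p Λ (fun ω => Q C x ∧ cluster S ω = C) * M := by
    intro x hx C
    by_cases hQ : Q C x
    · simp only [hQ, true_and, T]
      rw [bprob_indep p Λ (hull S C) (fun ω _ => cluster_inter_hull hQ.1)
        (fun ω _ => by simp only [Finset.sdiff_idem])]
      refine mul_le_mul_of_nonneg_left ((bprob_mono hp fun ω _ => Reach.mono ?_).trans (hM x hx))
        (bprob_nonneg hp _ _)
      exact_mod_cast Finset.sdiff_subset
    · simp [hQ, bprob, ind, bexp_const]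
  calc bprob p Λ (fun ω => Reach Λ ω 0)
      ≤ bprob p Λ (fun ω => ∃ x ∈ outerBdry S, ∃ C ∈ S.powerset, Q C x ∧ T x C ω) := by
        refine bprob_mono hp fun ω _ h => ?_
        obtain ⟨h1, x, hx, hy, hr⟩ := h.exists_outerBdry hS h0
        exact ⟨x, hx, cluster S ω, Finset.mem_powerset.2 (cluster_subset _ _), ⟨h1, hy⟩, rfl, hr⟩
    _ ≤ ∑ x ∈ outerBdry S, ∑ C ∈ S.powerset, bprob p Λ (fun ω => Q C x ∧ T x C ω) :=
        (bprob_exists_le hp _ _ _).trans (Finset.sum_le_sum fun x _ => bprob_exists_le hp _ _ _)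
    _ ≤ ∑ x ∈ outerBdry S, ∑ C ∈ S.powerset, bprob p Λ (fun ω => Q C x ∧ cluster S ω = C) * M :=
        Finset.sum_le_sum fun x hx => Finset.sum_le_sum fun C _ => step x hx C
    _ = (∑ x ∈ outerBdry S, bprob p Λ (fun ω => Link S ω x)) * M := by
        rw [Finset.sum_mul]
        refine Finset.sum_congr rfl fun x _ => ?_
        rw [← Finset.sum_mul]
        congr 1
        unfold bprob
        rw [← bexp_sum]
        refine bexp_congr p fun ω _ => ?_
        rw [Finset.sum_eq_single (cluster S ω)]
        · refine ind_congr ⟨?_, ?_⟩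
          · rintro ⟨⟨_, y, hy, hxy⟩, _⟩
            exact ⟨y, hxy, mem_cluster.1 hy⟩
          · rintro ⟨y, hxy, hy⟩
            exact ⟨⟨mem_cluster.2 (Conn.refl hy.left_mem), y, mem_cluster.2 hy, hxy⟩, rfl⟩
        · exact fun C _ hC => ind_false fun h => hC h.2.symm
        · exact fun h => absurd (Finset.mem_powerset.2 (cluster_subset _ _)) h
    _ = phi p S * M := by
        rw [phi]
        congr 1
        refine Finset.sum_congr rfl fun x _ => bprob_local p hS fun ω _ => ?_
        have : (ω : Set Site) ∩ S = ((ω ∩ S : Finset Site) : Set Site) ∩ S := by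
          ext v; simp
        simp only [Link, this]

lemma phi_mono {p q : ℝ} (hp : 0 ≤ p) (hpq : p ≤ q) (hq : q ≤ 1) (S : Finset Site) :
    phi p S ≤ phi q S :=
  Finset.sum_le_sum fun x _ => bexp_mono_param hp hpq hq S (ind_monotone
    fun _ _ h ⟨y, hxy, hy⟩ => ⟨y, hxy, hy.mono (Set.inter_subset_inter_left _
      (by exact_mod_cast h))⟩)

lemma phi_nonneg {p : ℝ} (hp : p ∈ Set.Icc (0 : ℝ) 1) (S : Finset Site) : 0 ≤ phi p S :=
  Finset.sum_nonneg fun _ _ => bprob_nonneg hp _ _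

lemma exists_subset_bx (S : Finset Site) : ∃ R, S ⊆ bx 0 R := by
  induction S using Finset.induction_on with
  | empty => exact ⟨0, Finset.empty_subset _⟩
  | insert v S _ ih =>
    obtain ⟨R, hR⟩ := ih
    refine ⟨max R (v.1.natAbs + v.2.natAbs), Finset.insert_subset ?_ (hR.trans ?_)⟩
    · simp only [mem_bx, Prod.fst_zero, Prod.snd_zero]; omega
    · exact bx_subset (by simp) (by simp)

lemma reachProb_le_phi_pow {p : ℝ} (hp : p ∈ Set.Icc (0 : ℝ) 1) {S : Finset Site} {R : ℕ}
    (hR : S ⊆ bx 0 R) (h0 : (0 : Site) ∈ S) (k : ℕ) :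
    reachProb p (k * (R + 1)) ≤ phi p S ^ k := by
  induction k with
  | zero => simpa using reachProb_le_one hp _
  | succ k ih =>
    have h1 : bx (0 : Site) R ⊆ bx 0 ((k + 1) * (R + 1)) := bx_subset
      (by simp only [sub_self, abs_zero]; exact_mod_cast (by nlinarith))
      (by simp only [sub_self, abs_zero]; exact_mod_cast (by nlinarith))
    rw [pow_succ']
    refine bprob_reach_le_phi_mul hp (hR.trans h1) h0 fun x hx => ?_
    have hsub : bx x (k * (R + 1)) ⊆ bx 0 ((k + 1) * (R + 1)) := by
      obtain ⟨_, y, hy, hxy⟩ := mem_outerBdry.1 hx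
      have hy' := mem_bx.1 (hR hy)
      have hx' := mem_bx.1 (mem_bx_one hxy)
      intro v hv
      rw [mem_bx] at hv ⊢
      simp only [Prod.fst_zero, Prod.snd_zero] at hy' ⊢
      rw [show (k + 1) * (R + 1) = k * (R + 1) + (R + 1) by ring]
      push_cast at *
      generalize (k : ℤ) * (R + 1) = K at *
      omega
    exact (bprob_reach_le hp hsub hsub).trans ih

theorem one_le_phi {p : ℝ} (hp : 1 / 2 ≤ p) (hp1 : p ≤ 1) {S : Finset Site}
    (h0 : (0 : Site) ∈ S) : 1 ≤ phi p S := by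
  refine le_trans ?_ (phi_mono (by norm_num) hp hp1 S)
  have hh : (1 / 2 : ℝ) ∈ Set.Icc (0 : ℝ) 1 := by norm_num
  by_contra! hlt
  obtain ⟨R, hR⟩ := exists_subset_bx S
  have hlim1 := tendsto_self_mul_const_pow_of_lt_one (phi_nonneg hh S) hlt
  have hlim2 := tendsto_pow_atTop_nhds_zero_of_lt_one (phi_nonneg hh S) hlt
  have hlim := ((hlim1.const_mul ((R : ℝ) + 1)).add (hlim2.const_mul 2))
  simp only [mul_zero, add_zero] at hlim
  obtain ⟨k, hk⟩ := (hlim.eventually (gt_mem_nhds (show (0 : ℝ) < 1 / 2 by norm_num))).exists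
  have h1 := half_le_mul_reachProb (k * (R + 1))
  have h2 := mul_le_mul_of_nonneg_left (reachProb_le_phi_pow hh hR h0 k)
    (show (0 : ℝ) ≤ ((k * (R + 1) : ℕ) : ℝ) + 2 by positivity)
  push_cast at h1 h2
  linarith [h1.trans h2]

/-- The site `v` is joined to the complement of `Λ`, or adjacent to such a site. -/
def Touch (Λ : Finset Site) (O : Set Site) (v : Site) : Prop :=
  ∃ y, (v = y ∨ triAdj v y) ∧ Reach Λ O y

lemma Reach.touch {Λ : Finset Site} {O : Set Site} {v : Site} (h : Reach Λ O v) : Touch Λ O v :=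
  ⟨v, Or.inl rfl, h⟩

lemma Reach.cons {Λ : Finset Site} {O : Set Site} {v w : Site} (h : Reach Λ O v)
    (hw : w ∈ O ∪ (Λ : Set Site)ᶜ) (hvw : triAdj w v) : Reach Λ O w := by
  obtain ⟨u, hu, h⟩ := h
  exact ⟨u, hu, ((Conn.refl hw).step hvw h.left_mem).trans h⟩

lemma reach_of_notMem {Λ : Finset Site} (O : Set Site) {v : Site} (h : v ∉ Λ) : Reach Λ O v :=
  ⟨v, h, Conn.refl (Or.inr h)⟩

lemma Touch.mono {Λ : Finset Site} {O O' : Set Site} {v : Site} (h : O ⊆ O') (hv : Touch Λ O v) :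
    Touch Λ O' v := by
  obtain ⟨y, hy, hr⟩ := hv
  exact ⟨y, hy, hr.mono h⟩

lemma Touch.reach {Λ : Finset Site} {O : Set Site} {v : Site} (h : Touch Λ O v)
    (hv : v ∈ O ∪ (Λ : Set Site)ᶜ) : Reach Λ O v := by
  obtain ⟨y, rfl | hy, hr⟩ := h
  · exact hr
  · exact hr.cons hv hy

open Classical in
/-- The sites of `Λ` that do not touch the cluster of the complement of `Λ`. -/
noncomputable def inner (Λ ω : Finset Site) : Finset Site := Λ.filter fun v => ¬ Touch Λ ω v

lemma mem_inner {Λ ω : Finset Site} {v : Site} : v ∈ inner Λ ω ↔ v ∈ Λ ∧ ¬ Touch Λ ω v := by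
  simp [inner]

lemma notMem_inner {Λ ω : Finset Site} {v : Site} (h : Touch Λ ω v) : v ∉ inner Λ ω :=
  fun h' => (mem_inner.1 h').2 h

lemma inner_congr {Λ ω ω' : Finset Site} (h : ∀ v, Reach Λ ω v ↔ Reach Λ ω' v) :
    inner Λ ω = inner Λ ω' := by
  ext v
  simp only [mem_inner, Touch, h]

lemma inner_sdiff {Λ ω S : Finset Site} : inner Λ ω = S ↔ inner Λ (ω \ S) = S := by
  have hsub : ((ω \ S : Finset Site) : Set Site) ⊆ ω := by exact_mod_cast Finset.sdiff_subset
  constructor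
  · intro h
    rw [← inner_congr (ω := ω) (ω' := ω \ S), h]
    refine fun v => ⟨fun ⟨u, hu, hvu⟩ => ⟨u, hu, ?_⟩, Reach.mono hsub⟩
    refine ((hvu.symm.inter_of_left (O' := {w | Reach Λ ω w}) fun w hw =>
      ⟨u, hu, hw.symm⟩).mono ?_).symm
    rintro x ⟨hx, hr⟩
    have hxS : x ∉ S := h ▸ notMem_inner (Reach.touch hr)
    exact hx.imp (fun hx' => Finset.mem_coe.2 (Finset.mem_sdiff.2 ⟨hx', hxS⟩)) id
  · intro h
    have key : ∀ u ∉ Λ, ∀ v, Conn ((ω : Set Site) ∪ (Λ : Set Site)ᶜ) u v →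
        Reach Λ ((ω \ S : Finset Site) : Set Site) v := by
      intro u hu v huv
      induction huv with
      | refl _ => exact reach_of_notMem _ hu
      | @step y z _ hyz hz ih =>
        have hzS : z ∉ S := h ▸ notMem_inner ⟨y, Or.inr (triAdj_symm hyz), ih⟩
        exact ih.cons (hz.imp (fun hx' => Finset.mem_coe.2 (Finset.mem_sdiff.2 ⟨hx', hzS⟩)) id)
          (triAdj_symm hyz)
    rw [inner_congr (ω := ω) (ω' := ω \ S), h]
    exact fun v => ⟨fun ⟨u, hu, hvu⟩ => key u hu v hvu.symm, Reach.mono hsub⟩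

lemma pivotal_of_link {Λ ω : Finset Site} {x : Site} (hx : x ∈ outerBdry (inner Λ ω))
    (h : Link (inner Λ ω) ω x) :
    x ∈ Λ ∧ Touch Λ ((insert x ω : Finset Site) : Set Site) 0 := by
  obtain ⟨hxS, -⟩ := mem_outerBdry.1 hx
  obtain ⟨y, hxy, hy⟩ := h
  have hyS : y ∈ inner Λ ω := hy.right_mem.2
  have hxr : ¬ Reach Λ ω x := fun hr =>
    (mem_inner.1 hyS).2 ⟨x, Or.inr (triAdj_symm hxy), hr⟩
  have hxΛ : x ∈ Λ := by
    by_contra hxΛ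
    exact hxr (reach_of_notMem _ hxΛ)
  refine ⟨hxΛ, ?_⟩
  have hxt : Touch Λ ω x := by
    by_contra hxt
    exact hxS (mem_inner.2 ⟨hxΛ, hxt⟩)
  have hsub : (ω : Set Site) ⊆ ((insert x ω : Finset Site) : Set Site) := by
    exact_mod_cast Finset.subset_insert x ω
  have hx' : Reach Λ ((insert x ω : Finset Site) : Set Site) x :=
    (hxt.mono hsub).reach (Or.inl (by simp))
  obtain ⟨u, hu, hxu⟩ := hx'
  refine Reach.touch ⟨u, hu, ?_⟩
  have h1 := (hy.mono (Set.inter_subset_left.trans hsub)).mono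
    (Set.subset_union_left (t := (Λ : Set Site)ᶜ))
  exact (h1.step (triAdj_symm hxy) hxu.left_mem).trans hxu

/-- The probability that the ball of radius `n` has an open path from the neighbourhood of the
origin to its complement. -/
noncomputable def touchProb (p : ℝ) (n : ℕ) : ℝ := bprob p (bx 0 n) fun ω => Touch (bx 0 n) ω 0

lemma one_sub_touchProb_le_deriv {p : ℝ} (hp : 1 / 2 ≤ p) (hp1 : p ≤ 1) (n : ℕ) :
    1 - touchProb p n ≤ ∑ v ∈ bx 0 n, bexp p (bx 0 n) fun ω =>
      ind (Touch (bx 0 n) ((insert v ω : Finset Site) : Set Site) 0)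
        - ind (Touch (bx 0 n) ((ω.erase v : Finset Site) : Set Site) 0) := by
  classical
  have hpI : p ∈ Set.Icc (0 : ℝ) 1 := ⟨by linarith, hp1⟩
  set Λ := bx (0 : Site) n with hΛ
  let I : Finset (Finset Site) := Λ.powerset.filter fun S => (0 : Site) ∈ S
  have h0Λ : (0 : Site) ∈ Λ := self_mem_bx 0 n
  have hD : ∀ (ω : Finset Site) (v : Site), 0 ≤
      ind (Touch Λ ((insert v ω : Finset Site) : Set Site) 0)
        - ind (Touch Λ ((ω.erase v : Finset Site) : Set Site) 0) := fun ω v =>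
    sub_nonneg.2 (ind_mono (Touch.mono (by
      exact_mod_cast (Finset.erase_subset v ω).trans (Finset.subset_insert v ω))))
  calc 1 - touchProb p n = bprob p Λ (fun ω => ¬ Touch Λ ω 0) := (bprob_not p Λ _).symm
    _ ≤ bprob p Λ (fun ω => ∃ S ∈ I, inner Λ ω = S) := by
        refine bprob_mono hpI fun ω _ h => ⟨inner Λ ω, ?_, rfl⟩
        exact Finset.mem_filter.2 ⟨Finset.mem_powerset.2 fun v hv => (mem_inner.1 hv).1,
          mem_inner.2 ⟨h0Λ, h⟩⟩
    _ ≤ ∑ S ∈ I, bprob p Λ (fun ω => inner Λ ω = S) := bprob_exists_le hpI _ _ _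
    _ ≤ ∑ S ∈ I, bprob p Λ (fun ω => inner Λ ω = S) * phi p S := by
        refine Finset.sum_le_sum fun S hS => ?_
        have := one_le_phi hp hp1 (Finset.mem_filter.1 hS).2
        exact le_mul_of_one_le_right (bprob_nonneg hpI _ _) this
    _ = ∑ S ∈ I, ∑ x ∈ outerBdry S, bprob p Λ (fun ω => Link S ω x ∧ inner Λ ω = S) := by
        refine Finset.sum_congr rfl fun S hS => ?_
        have hSΛ := Finset.mem_powerset.1 (Finset.mem_filter.1 hS).1
        rw [phi, Finset.mul_sum]
        refine Finset.sum_congr rfl fun x _ => ?_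
        have hloc : ∀ ω : Finset Site,
            Link S ω x ↔ Link S ((ω ∩ S : Finset Site) : Set Site) x := by
          intro ω
          have : (ω : Set Site) ∩ S = ((ω ∩ S : Finset Site) : Set Site) ∩ S := by
            ext v; simp
          simp only [Link, this]
        rw [bprob_indep p Λ S (fun ω _ => hloc ω) (fun ω _ => inner_sdiff), mul_comm]
        congr 1
        exact (bprob_local p hSΛ (F := fun ω => Link S ω x) fun ω _ => hloc ω).symm
    _ = bexp p Λ (fun ω => ∑ S ∈ I, ∑ x ∈ outerBdry S, ind (Link S ω x ∧ inner Λ ω = S)) := by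
        simp only [bprob, bexp_sum]
    _ ≤ bexp p Λ (fun ω => ∑ v ∈ Λ, (ind (Touch Λ ((insert v ω : Finset Site) : Set Site) 0)
        - ind (Touch Λ ((ω.erase v : Finset Site) : Set Site) 0))) := by
        refine bexp_mono hpI fun ω _ => ?_
        have hzero : ∀ S ∈ I, S ≠ inner Λ ω →
            ∑ x ∈ outerBdry S, ind (Link S ω x ∧ inner Λ ω = S) = 0 := fun S _ hne =>
          Finset.sum_eq_zero fun x _ => ind_false fun h => hne h.2.symm
        by_cases hI : inner Λ ω ∈ I
        · rw [Finset.sum_eq_single_of_mem _ hI hzero]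
          have hnt := (mem_inner.1 (Finset.mem_filter.1 hI).2).2
          rw [← Finset.sum_filter_add_sum_filter_not (outerBdry (inner Λ ω))
            (fun x => Link (inner Λ ω) ω x)]
          have e1 : ∑ x ∈ outerBdry (inner Λ ω) with ¬ Link (inner Λ ω) ω x,
              ind (Link (inner Λ ω) ω x ∧ inner Λ ω = inner Λ ω) = 0 :=
            Finset.sum_eq_zero fun x hx => ind_false fun h => (Finset.mem_filter.1 hx).2 h.1
          rw [e1, add_zero]
          refine (Finset.sum_le_sum fun x hx => ?_).trans
            (Finset.sum_le_sum_of_subset_of_nonneg ?_ fun v _ _ => hD ω v)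
          · obtain ⟨hx1, hx2⟩ := Finset.mem_filter.1 hx
            rw [ind_true (pivotal_of_link hx1 hx2).2, ind_false (P := Touch Λ
              ((ω.erase x : Finset Site) : Set Site) 0) fun h => hnt (h.mono (by
                exact_mod_cast Finset.erase_subset x ω)), sub_zero]
            exact ind_le_one _
          · intro x hx
            obtain ⟨hx1, hx2⟩ := Finset.mem_filter.1 hx
            exact (pivotal_of_link hx1 hx2).1
        · rw [Finset.sum_eq_zero fun S hS => hzero S hS fun h => hI (h ▸ hS)]
          exact Finset.sum_nonneg fun v _ => hD ω v
    _ = _ := bexp_sum p Λ _ _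

lemma touchProb_lower {p : ℝ} (hp : 1 / 2 < p) (hp1 : p ≤ 1) (n : ℕ) :
    (p - 1 / 2) / 2 ≤ touchProb p n := by
  have hderiv : ∀ q, HasDerivAt (fun q => touchProb q n) _ q := fun q =>
    hasDerivAt_bexp q (bx 0 n) fun ω => ind (Touch (bx 0 n) ω 0)
  obtain ⟨q, hq, hslope⟩ := exists_hasDerivAt_eq_slope (fun q => touchProb q n) _ hp
    (fun q _ => (hderiv q).continuousAt.continuousWithinAt) fun q _ => hderiv q
  have h1 := one_sub_touchProb_le_deriv hq.1.le (hq.2.le.trans hp1) n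
  rw [hslope, le_div_iff₀ (by linarith)] at h1
  have h2 : touchProb q n ≤ touchProb p n := bexp_mono_param (by linarith [hq.1]) hq.2.le hp1 _
    (ind_monotone fun _ _ h => Touch.mono (by exact_mod_cast h))
  have h3 : 0 ≤ touchProb (1 / 2) n := bprob_nonneg (by norm_num) _ _
  have h4 : touchProb p n ≤ 1 := bprob_le_one ⟨by linarith, hp1⟩ _ _
  nlinarith

/-- For `p > 1/2`, connection probabilities are bounded below uniformly in the radius. -/
theorem reachProb_lower {p : ℝ} (hp : 1 / 2 < p) (hp1 : p ≤ 1) (n : ℕ) :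
    (p - 1 / 2) / 4 ≤ reachProb p n := by
  have hpI : p ∈ Set.Icc (0 : ℝ) 1 := ⟨by linarith, hp1⟩
  have h1 := touchProb_lower hp hp1 n
  have h2 : bprob p (bx 0 n) (fun ω => (0 : Site) ∈ ω) = p := by
    rw [bprob_local p (A := {0}) (F := fun ω => (0 : Site) ∈ ω)
      (Finset.singleton_subset_iff.2 (self_mem_bx 0 n)) (fun ω _ => by simp), bprob,
      ← insert_empty_eq, bexp_insert p (Finset.notMem_empty _), bexp_empty, bexp_empty,
      ind_true (by simp), ind_false (by simp)]
    ring
  have h3 := bexp_fkg hpI (bx 0 n) (ind_monotone (A := fun ω => (0 : Site) ∈ ω)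
    fun _ _ h h' => h h') (ind_monotone (A := fun ω : Finset Site => Touch (bx 0 n) ω 0)
    fun _ _ h => Touch.mono (by exact_mod_cast h))
  change bprob p (bx 0 n) (fun ω => (0 : Site) ∈ ω) * touchProb p n ≤ _ at h3
  rw [h2] at h3
  have h4 : bexp p (bx 0 n) (fun ω => ind ((0 : Site) ∈ ω) * ind (Touch (bx 0 n) ω 0))
      ≤ reachProb p n := by
    refine bexp_mono hpI fun ω _ => ?_
    rw [← ind_and]
    exact ind_mono fun h => h.2.reach (Or.inl h.1)
  have h5 := h3.trans h4
  nlinarith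

/-- The open sites of `ω` in `Λ`. -/
def opens (Λ : Finset Site) (ω : Config) : Finset Site := Λ.filter fun v => ω v = true

section Measure

lemma opens_eq_iff {Λ S : Finset Site} (hS : S ⊆ Λ) (ω : Config) :
    opens Λ ω = S ↔ ∀ v ∈ Λ, ω v = decide (v ∈ S) := by
  have h1 : ∀ v, ω v = decide (v ∈ S) ↔ (ω v = true ↔ v ∈ S) := fun v => by
    by_cases hv : v ∈ S <;> simp [hv]
  simp only [opens, Finset.ext_iff, Finset.mem_filter, h1]
  exact ⟨fun h v hv => by simpa [hv] using h v, fun h v =>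
    ⟨fun hv => (h v hv.1).1 hv.2, fun hv => ⟨hS hv, (h v (hS hv)).2 hv⟩⟩⟩

lemma measurableSet_forall_eq (Λ : Finset Site) (f : Site → Bool) :
    MeasurableSet {ω : Config | ∀ v ∈ Λ, ω v = f v} := by
  have : {ω : Config | ∀ v ∈ Λ, ω v = f v} = ⋂ v ∈ Λ, (fun ω : Config => ω v) ⁻¹' {f v} := by
    ext ω; simp
  rw [this]
  exact Finset.measurableSet_biInter _ fun v _ => measurable_pi_apply v (MeasurableSet.singleton _)

open Classical in
lemma setOf_opens_eq_biUnion (Λ : Finset Site) (E : Finset Site → Prop) :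
    {ω : Config | E (opens Λ ω)} = ⋃ S ∈ Λ.powerset.filter E,
      {ω : Config | ∀ v ∈ Λ, ω v = decide (v ∈ S)} := by
  ext ω
  simp only [Set.mem_ofPred_eq, Set.mem_iUnion, Finset.mem_filter, Finset.mem_powerset, exists_prop]
  constructor
  · intro h
    have hsub : opens Λ ω ⊆ Λ := Finset.filter_subset _ _
    exact ⟨opens Λ ω, ⟨hsub, h⟩, (opens_eq_iff hsub ω).1 rfl⟩
  · rintro ⟨S, ⟨hS, hE⟩, h⟩
    rwa [(opens_eq_iff hS ω).2 h]

lemma measurableSet_setOf_opens (Λ : Finset Site) (E : Finset Site → Prop) :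
    MeasurableSet {ω : Config | E (opens Λ ω)} := by
  classical
  rw [setOf_opens_eq_biUnion]
  exact Finset.measurableSet_biUnion _ fun S _ => measurableSet_forall_eq Λ _

lemma measure_setOf_opens {p : ℝ} (hp : p ∈ Set.Icc (0 : ℝ) 1) {μ : Measure Config}
    (hμ : IsBernoulliPercolation p μ) (Λ : Finset Site) (E : Finset Site → Prop) :
    μ {ω : Config | E (opens Λ ω)} = ENNReal.ofReal (bprob p Λ E) := by
  classical
  have h1p : 0 ≤ 1 - p := sub_nonneg.2 hp.2
  rw [setOf_opens_eq_biUnion, measure_biUnion_finset]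
  · have hterm : ∀ S ∈ Λ.powerset.filter E, μ {ω : Config | ∀ v ∈ Λ, ω v = decide (v ∈ S)}
        = ENNReal.ofReal (p ^ S.card * (1 - p) ^ (Λ \ S).card) := by
      intro S hS
      have hSΛ := Finset.mem_powerset.1 (Finset.mem_filter.1 hS).1
      rw [hμ.2 Λ fun v => decide (v ∈ S)]
      simp only [decide_eq_true_eq]
      rw [Finset.prod_ite, Finset.prod_const, Finset.prod_const,
        ENNReal.ofReal_mul (pow_nonneg hp.1 _), ENNReal.ofReal_pow hp.1, ENNReal.ofReal_pow h1p]
      congr 3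
      · rw [Finset.filter_mem_eq_inter, Finset.inter_eq_right.2 hSΛ]
      · rw [Finset.filter_notMem_eq_sdiff]
    rw [Finset.sum_congr rfl hterm, ← ENNReal.ofReal_sum_of_nonneg fun S _ =>
      mul_nonneg (pow_nonneg hp.1 _) (pow_nonneg h1p _), Finset.sum_filter]
    congr 1
    refine Finset.sum_congr rfl fun S _ => ?_
    by_cases hE : E S <;> simp [ind, hE]
  · intro S hS T hT hST
    have hS' := Finset.mem_powerset.1 (Finset.mem_filter.1 hS).1
    have hT' := Finset.mem_powerset.1 (Finset.mem_filter.1 hT).1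
    refine Set.disjoint_left.2 fun ω h1 h2 => hST ?_
    rw [← (opens_eq_iff hS' ω).2 h1, ← (opens_eq_iff hT' ω).2 h2]
  · exact fun S _ => measurableSet_forall_eq Λ _

lemma exists_isBernoulliPercolation {p : ℝ} (hp : p ∈ Set.Icc (0 : ℝ) 1) :
    ∃ μ : Measure Config, IsBernoulliPercolation p μ := by
  let ν : Measure Bool := ENNReal.ofReal p • Measure.dirac true
    + ENNReal.ofReal (1 - p) • Measure.dirac false
  have hν : IsProbabilityMeasure ν := ⟨by
    simp only [ν, Measure.coe_add, Measure.coe_smul, Pi.add_apply, Pi.smul_apply, measure_univ,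
      smul_eq_mul, mul_one]
    rw [← ENNReal.ofReal_add hp.1 (sub_nonneg.2 hp.2)]
    simp⟩
  refine ⟨Measure.infinitePi fun _ => ν, inferInstance, fun S f => ?_⟩
  have : {ω : Config | ∀ v ∈ S, ω v = f v} = (S : Set Site).pi fun v => {f v} := by
    ext ω; simp [Set.mem_pi]
  rw [this, Measure.infinitePi_pi _ fun v _ => MeasurableSet.singleton _]
  refine Finset.prod_congr rfl fun v _ => ?_
  cases f v <;> simp [ν]

end Measure

section Cluster

lemma mem_openCluster_iff {ω : Config} {v w : Site} :
    w ∈ openCluster ω v ↔ Conn {x | ω x = true} v w := by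
  constructor
  · rintro ⟨l, ⟨_, hchain, hopen⟩, hhead, hlast⟩
    induction l generalizing v with
    | nil => simp at hhead
    | cons a l ih =>
      obtain rfl : a = v := by simpa using hhead
      have ha : ω a = true := hopen a (by simp)
      cases l with
      | nil =>
        obtain rfl : a = w := by simpa using hlast
        exact Conn.refl ha
      | cons b l =>
        obtain ⟨hab, hchain'⟩ := List.isChain_cons_cons.1 hchain
        have := ih (v := b) (by simp) hchain' (fun x hx => hopen x (by simp [hx])) (by simp)
          (by simpa using hlast)
        exact ((Conn.refl ha).step hab this.left_mem).trans this
  · intro h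
    induction h with
    | refl h => exact ⟨[v], ⟨by simp, List.isChain_singleton v, by simpa using h⟩, rfl, rfl⟩
    | @step y z h hyz hz ih =>
      obtain ⟨l, ⟨hl, hchain, hopen⟩, hhead, hlast⟩ := ih
      refine ⟨l ++ [z], ⟨by simp, ?_, ?_⟩, ?_, by simp⟩
      · refine List.isChain_append.2 ⟨hchain, List.isChain_singleton z, ?_⟩
        intro x hx x' hx'
        rw [hlast] at hx
        simp only [Option.mem_def, Option.some.injEq, List.head?_cons] at hx hx'
        rwa [← hx, ← hx']
      · intro x hx
        rcases List.mem_append.1 hx with h' | h'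
        · exact hopen x h'
        · rw [List.mem_singleton.1 h']; exact hz
      · rw [List.head?_append, hhead]; rfl

lemma infinite_openCluster_iff {ω : Config} :
    (openCluster ω (0, 0)).Infinite ↔ ∀ n, Reach (bx 0 n) (opens (bx 0 n) ω) 0 := by
  have hset : ∀ n, ((opens (bx 0 n) ω : Finset Site) : Set Site) ∪ ((bx 0 n : Finset Site) :
      Set Site)ᶜ = {x | ω x = true} ∪ ((bx 0 n : Finset Site) : Set Site)ᶜ := by
    intro n
    ext x
    simp only [opens, Finset.coe_filter, Set.mem_union, Set.mem_ofPred_eq, Set.mem_compl_iff,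
      SetLike.mem_coe]
    tauto
  simp only [Reach, hset]
  constructor
  · intro h n
    obtain ⟨w, hw, hn⟩ := h.exists_notMem_finset (bx 0 n)
    exact ⟨w, hn, (mem_openCluster_iff.1 hw).mono Set.subset_union_left⟩
  · intro h hfin
    obtain ⟨R, hR⟩ := exists_subset_bx hfin.toFinset
    obtain ⟨u, hu, hconn⟩ := h (R + 1)
    obtain ⟨a, b, h0a, hab, _, hb⟩ := hconn.exists_exit (fun x => x ∈ bx 0 (R + 1))
      (self_mem_bx 0 _) hu
    have ha : a ∈ bx 0 R := by
      refine hR (hfin.mem_toFinset.2 (mem_openCluster_iff.2 (h0a.mono ?_)))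
      rintro x ⟨hx | hx, hx'⟩
      · exact hx
      · exact absurd hx' hx
    refine hb ?_
    have hb' := mem_bx_one (triAdj_symm hab)
    rw [mem_bx] at ha hb' ⊢
    push_cast at *
    omega

variable {p : ℝ} {μ : Measure Config}

lemma setOf_infinite_eq_iInter : {ω | (openCluster ω (0, 0)).Infinite}
    = ⋂ n, {ω : Config | Reach (bx 0 n) (opens (bx 0 n) ω) 0} := by
  ext ω
  simp only [Set.mem_ofPred_eq, Set.mem_iInter, infinite_openCluster_iff]

lemma measure_infinite_le (hp : p ∈ Set.Icc (0 : ℝ) 1) (hμ : IsBernoulliPercolation p μ) (n : ℕ) :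
    μ {ω | (openCluster ω (0, 0)).Infinite} ≤ ENNReal.ofReal (reachProb p n) := by
  rw [reachProb, ← measure_setOf_opens hp hμ, setOf_infinite_eq_iInter]
  exact measure_mono (Set.iInter_subset _ n)

lemma le_measure_infinite (hp : p ∈ Set.Icc (0 : ℝ) 1) (hμ : IsBernoulliPercolation p μ) {c : ℝ}
    (hc : ∀ n, c ≤ reachProb p n) :
    ENNReal.ofReal c ≤ μ {ω | (openCluster ω (0, 0)).Infinite} := by
  have := hμ.1
  rw [setOf_infinite_eq_iInter]
  refine ge_of_tendsto' (tendsto_measure_iInter_atTop (fun n => (measurableSet_setOf_opens (bx 0 n)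
    fun S => Reach (bx 0 n) S 0).nullMeasurableSet) ?_ ⟨0, measure_ne_top _ _⟩) fun n => ?_
  · intro n m hnm ω h
    have hsub : bx 0 n ⊆ bx 0 m := bx_subset (by simpa using hnm) (by simpa using hnm)
    have h1 := Reach.anti hsub h
    rw [reach_inter_iff] at h1
    refine h1.mono ?_
    intro x hx
    simp only [opens, Finset.coe_inter, Finset.coe_filter, Set.mem_inter_iff, Set.mem_ofPred_eq,
      SetLike.mem_coe] at hx ⊢
    exact ⟨hx.2, hx.1.2⟩
  · simp only [Function.comp_apply]
    rw [measure_setOf_opens hp hμ (bx 0 n) fun S => Reach (bx 0 n) S 0]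
    exact ENNReal.ofReal_le_ofReal (hc n)

end Cluster

lemma pcSite_le_half_of_mem {p : ℝ} (hp : p ∈ Set.Icc (0 : ℝ) 1)
    (h : ∀ μ : Measure Config, IsBernoulliPercolation p μ →
      μ {ω | (openCluster ω (0, 0)).Infinite} = 0) : p ≤ 1 / 2 := by
  by_contra! hlt
  obtain ⟨μ, hμ⟩ := exists_isBernoulliPercolation hp
  have h1 := le_measure_infinite hp hμ (reachProb_lower hlt hp.2)
  rw [h μ hμ, nonpos_iff_eq_zero, ENNReal.ofReal_eq_zero] at h1
  linarith

lemma bprob_forall_not_reach (p : ℝ) (r k : ℕ) {Λ : Finset Site}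
    (hΛ : ∀ i < k, bx (((i * (2 * r + 1) : ℕ) : ℤ), 0) r ⊆ Λ) :
    bprob p Λ (fun ω => ∀ i < k, ¬ Reach (bx (((i * (2 * r + 1) : ℕ) : ℤ), 0) r) ω
      (((i * (2 * r + 1) : ℕ) : ℤ), 0)) = (1 - reachProb p r) ^ k := by
  induction k with
  | zero => simp [bprob, ind, bexp_const]
  | succ k ih =>
    set x : ℕ → Site := fun i => (((i * (2 * r + 1) : ℕ) : ℤ), 0) with hx
    have hdisj : ∀ i < k, ∀ v ∈ bx (x i) r, v ∉ bx (x k) r := by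
      intro i hi v hv hv'
      rw [mem_bx] at hv hv'
      simp only [hx] at hv hv'
      have h1 : (i + 1) * (2 * r + 1) ≤ k * (2 * r + 1) := Nat.mul_le_mul_right _ hi
      rw [add_mul, one_mul] at h1
      generalize i * (2 * r + 1) = a at *
      generalize k * (2 * r + 1) = b at *
      omega
    have hloc : ∀ ω : Finset Site, ∀ i < k, (Reach (bx (x i) r) ω (x i) ↔
        Reach (bx (x i) r) ((ω \ bx (x k) r : Finset Site) : Set Site) (x i)) := by
      intro ω i hi
      rw [reach_inter_iff, reach_inter_iff (ω := ω \ bx (x k) r)]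
      have : ω ∩ bx (x i) r = (ω \ bx (x k) r) ∩ bx (x i) r := by
        ext v
        simp only [Finset.mem_inter, Finset.mem_sdiff]
        have := hdisj i hi v
        tauto
      rw [this]
    have h1 := bprob_indep p Λ (bx (x k) r) (E := fun ω => ¬ Reach (bx (x k) r) ω (x k))
      (F := fun ω => ∀ i < k, ¬ Reach (bx (x i) r) ω (x i))
      (fun ω _ => not_congr reach_inter_iff)
      (fun ω _ => forall₂_congr fun i hi => not_congr (hloc ω i hi))
    rw [ih fun i hi => hΛ i (by omega), bprob_not p Λ fun ω => Reach (bx (x k) r) ω (x k),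
      bprob_reach_self p (hΛ k (by omega))] at h1
    rw [pow_succ', ← h1]
    refine bexp_congr p fun ω _ => ind_congr ?_
    exact Nat.forall_lt_succ_right.trans and_comm

lemma exists_ball_reach {p θ : ℝ} (hp : p ∈ Set.Icc (0 : ℝ) 1) (hθ : 0 < θ)
    (h : ∀ n, θ ≤ reachProb p n) {δ : ℝ} (hδ : 0 < δ) :
    ∃ m, ∀ L ≥ m, 1 - δ ≤ bprob p (bx 0 L) fun ω => ∃ v ∈ bx 0 m, Reach (bx 0 L) ω v := by
  have hθ1 : θ ≤ 1 := (h 0).trans (reachProb_le_one hp 0)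
  obtain ⟨k, hk⟩ := exists_pow_lt_of_lt_one (half_pos hδ) (show 1 - θ < 1 by linarith)
  set l := ⨅ n, reachProb p n with hl
  have hbdd : BddBelow (Set.range (reachProb p)) :=
    ⟨0, by rintro _ ⟨n, rfl⟩; exact reachProb_nonneg hp n⟩
  have hle : ∀ n, l ≤ reachProb p n := fun n => ciInf_le hbdd n
  obtain ⟨r, hr⟩ : ∃ r, reachProb p r < l + δ / (2 * (k + 1)) :=
    exists_lt_of_ciInf_lt (lt_add_of_pos_right _ (by positivity))
  refine ⟨k * (2 * r + 1) + r, fun L hL => ?_⟩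
  set m := k * (2 * r + 1) + r with hm
  let x : ℕ → Site := fun i => (((i * (2 * r + 1) : ℕ) : ℤ), 0)
  have hxk : ∀ i < k, i * (2 * r + 1) + r ≤ m := fun i hi =>
    Nat.add_le_add_right (Nat.mul_le_mul_right _ hi.le) _
  have hsub : ∀ i < k, bx (x i) r ⊆ bx 0 L := by
    intro i hi v hv
    have := hxk i hi
    simp only [mem_bx, x, Prod.fst_zero, Prod.snd_zero] at hv ⊢
    generalize i * (2 * r + 1) = a at *
    omega
  have hsub' : ∀ i < k, bx 0 L ⊆ bx (x i) (L + m) := by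
    intro i hi v hv
    have := hxk i hi
    simp only [mem_bx, x, Prod.fst_zero, Prod.snd_zero] at hv ⊢
    generalize i * (2 * r + 1) = a at *
    push_cast
    omega
  have hdiff : ∀ i ∈ Finset.range k, bprob p (bx 0 L) (fun ω => Reach (bx (x i) r) ω (x i) ∧
      ¬ Reach (bx 0 L) ω (x i)) ≤ δ / (2 * (k + 1)) := by
    intro i hi
    have hi' := Finset.mem_range.1 hi
    have e1 := bprob_reach_self p (hsub i hi')
    have e2 : reachProb p (L + m) ≤ bprob p (bx 0 L) fun ω => Reach (bx 0 L) ω (x i) := by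
      rw [← bprob_reach_self p (Finset.Subset.refl (bx (x i) (L + m))),
        ← bprob_local p (hsub' i hi') (E := fun ω => Reach (bx 0 L) ω (x i))
          (F := fun ω => Reach (bx 0 L) ω (x i)) fun ω _ => reach_inter_iff]
      exact bprob_mono hp fun ω _ => Reach.anti (hsub' i hi')
    have e3 : bprob p (bx 0 L) (fun ω => Reach (bx (x i) r) ω (x i) ∧ ¬ Reach (bx 0 L) ω (x i))
        = bprob p (bx 0 L) (fun ω => Reach (bx (x i) r) ω (x i))
          - bprob p (bx 0 L) (fun ω => Reach (bx 0 L) ω (x i)) := by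
      unfold bprob
      rw [← bexp_sub]
      refine bexp_congr p fun ω _ => ?_
      rw [ind_and, ind_not]
      by_cases hR : Reach (bx 0 L) ω (x i)
      · rw [ind_true hR, ind_true (hR.anti (hsub i hi'))]; ring
      · rw [ind_false hR]; ring
    have := hle (L + m)
    linarith
  have hmem : ∀ i < k, x i ∈ bx 0 m := by
    intro i hi
    have := hxk i hi
    simp only [mem_bx, x, Prod.fst_zero, Prod.snd_zero]
    generalize i * (2 * r + 1) = a at *
    omega
  have hnot : bprob p (bx 0 L) (fun ω => ¬ ∃ v ∈ bx 0 m, Reach (bx 0 L) ω v) ≤ δ := by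
    calc bprob p (bx 0 L) (fun ω => ¬ ∃ v ∈ bx 0 m, Reach (bx 0 L) ω v)
        ≤ bprob p (bx 0 L) (fun ω => (∀ i < k, ¬ Reach (bx (x i) r) ω (x i)) ∨
          ∃ i ∈ Finset.range k, Reach (bx (x i) r) ω (x i) ∧ ¬ Reach (bx 0 L) ω (x i)) := by
          refine bprob_mono hp fun ω _ hω => ?_
          by_cases hE : ∀ i < k, ¬ Reach (bx (x i) r) ω (x i)
          · exact Or.inl hE
          · push Not at hE
            obtain ⟨i, hi, hr⟩ := hE
            exact Or.inr ⟨i, Finset.mem_range.2 hi, hr, fun hR => hω ⟨x i, hmem i hi, hR⟩⟩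
      _ ≤ (1 - reachProb p r) ^ k + ∑ i ∈ Finset.range k, δ / (2 * (k + 1)) :=
          (bprob_or_le hp _ _ _).trans (add_le_add (bprob_forall_not_reach p r k hsub).le
            ((bprob_exists_le hp _ _ _).trans (Finset.sum_le_sum hdiff)))
      _ ≤ δ / 2 + δ / 2 := by
          refine add_le_add ((pow_le_pow_left₀ (sub_nonneg.2 (reachProb_le_one hp r))
            (sub_le_sub_left (h r) 1) k).trans hk.le) ?_
          rw [Finset.sum_const, Finset.card_range, nsmul_eq_mul, mul_div_assoc',
            div_le_div_iff₀ (by positivity) (by norm_num)]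
          nlinarith
      _ = δ := add_halves δ
  rw [bprob_not p (bx 0 L) fun ω => ∃ v ∈ bx 0 m, Reach (bx 0 L) ω v] at hnot
  linarith

/-- Inside the ball of radius `L` around `x`, the ball of radius `m` around `x` is joined in `O` to
a site whose position relative to `x` satisfies `Q`. -/
def Arm (x : Site) (m L : ℕ) (Q : Site → Prop) (O : Set Site) : Prop :=
  ∃ u ∈ bx x m, ∃ v, Conn (O ∩ bx x L) u v ∧ Q (v - x)

/-- The ball of radius `m` around `x` has open arms to the vertical sides and closed arms to the
horizontal sides of the ball of radius `L` around `x`. -/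
def FourArm (x : Site) (m L : ℕ) (O : Set Site) : Prop :=
  (Arm x m L (fun v => v.1 = L) O ∧ Arm x m L (fun v => v.1 = -L) O) ∧
    Arm x m L (fun v => v.2 = L) Oᶜ ∧ Arm x m L (fun v => v.2 = -L) Oᶜ

lemma Arm.mono {x : Site} {m L : ℕ} {Q : Site → Prop} {O O' : Set Site} (hO : O ⊆ O')
    (h : Arm x m L Q O) : Arm x m L Q O' := by
  obtain ⟨u, hu, v, huv, hv⟩ := h
  exact ⟨u, hu, v, huv.mono (Set.inter_subset_inter_left _ hO), hv⟩

lemma arm_congr {x : Site} {m L : ℕ} {Q : Site → Prop} {O O' : Set Site}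
    (h : O ∩ bx x L = O' ∩ bx x L) : Arm x m L Q O ↔ Arm x m L Q O' := by
  simp only [Arm, h]

lemma arm_map_iff (e : Site ≃ Site) (he : ∀ a b, triAdj (e a) (e b) ↔ triAdj a b) {x y : Site}
    (hbx : ∀ n, (bx x n).map e.toEmbedding = bx y n) {m L : ℕ} {Q Q' : Site → Prop}
    (hQ : ∀ v, Q' (e v - y) ↔ Q (v - x)) {O : Set Site} :
    Arm y m L Q' (e '' O) ↔ Arm x m L Q O := by
  have h1 : (e '' O) ∩ (bx y L : Set Site) = e '' (O ∩ bx x L) := by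
    rw [Set.image_inter e.injective, ← hbx, Finset.coe_map]; rfl
  have h2 : ∀ u, e u ∈ bx y m ↔ u ∈ bx x m := fun u => by
    rw [← hbx]; simp
  unfold Arm
  rw [h1]
  constructor
  · rintro ⟨u, hu, v, huv, hv⟩
    refine ⟨e.symm u, (h2 _).1 (by simpa using hu), e.symm v, ?_, (hQ _).1 (by simpa using hv)⟩
    rw [← Conn.map_iff e he]; simpa using huv
  · rintro ⟨u, hu, v, huv, hv⟩
    exact ⟨e u, (h2 _).2 hu, e v, (Conn.map_iff e he).2 huv, (hQ _).2 hv⟩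

lemma bprob_arm_symm (p : ℝ) (e : Site ≃ Site) (he : ∀ a b, triAdj (e a) (e b) ↔ triAdj a b)
    (hbx : ∀ n, (bx 0 n).map e.toEmbedding = bx 0 n) {m L : ℕ} {Q Q' R R' : Site → Prop}
    (hQ : ∀ v, Q' (e v) ↔ Q v) (hR : ∀ v, R' (e v) ↔ R v) :
    bprob p (bx 0 L) (fun ω => Arm 0 m L Q' ω ∨ Arm 0 m L R' ω)
      = bprob p (bx 0 L) fun ω => Arm 0 m L Q ω ∨ Arm 0 m L R ω := by
  rw [← hbx L, bprob_map, hbx]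
  refine bexp_congr p fun ω _ => ind_congr ?_
  beta_reduce
  rw [Finset.coe_map]
  exact or_congr (arm_map_iff e he hbx (by simpa using hQ))
    (arm_map_iff e he hbx (by simpa using hR))

lemma exists_arm_of_reach {m L : ℕ} (hmL : m ≤ L) {O : Set Site}
    (h : ∃ v ∈ bx 0 m, Reach (bx 0 L) O v) :
    (Arm 0 m L (fun v => v.1 = L) O ∨ Arm 0 m L (fun v => v.1 = -L) O) ∨
      (Arm 0 m L (fun v => v.2 = L) O ∨ Arm 0 m L (fun v => v.2 = -L) O) := by
  obtain ⟨u, hu, w, hw, huw⟩ := h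
  have hu' : u ∈ bx 0 L := by
    rw [mem_bx] at hu ⊢; omega
  obtain ⟨a, b, hua, hab, -, hb⟩ := huw.exists_exit (fun x => x ∈ bx 0 L) hu' hw
  have ha := hua.right_mem.2
  have hua' : Conn (O ∩ bx 0 L) u a := by
    refine hua.mono ?_
    rintro x ⟨hx | hx, hx'⟩
    · exact ⟨hx, hx'⟩
    · exact absurd hx' hx
  have : (a.1 = L ∨ a.1 = -L) ∨ (a.2 = L ∨ a.2 = -L) := by
    rw [triAdj_iff] at hab
    simp only [Set.mem_ofPred_eq, mem_bx, Prod.fst_zero, Prod.snd_zero] at ha hb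
    omega
  refine this.imp (Or.imp ?_ ?_) (Or.imp ?_ ?_) <;>
    exact fun h => ⟨u, hu, a, hua', by simpa using h⟩

lemma exists_arm_prob {p θ : ℝ} (hp : p ∈ Set.Icc (0 : ℝ) 1) (hθ : 0 < θ)
    (h : ∀ n, θ ≤ reachProb p n) : ∃ m, ∀ L ≥ m,
      (7 / 8 ≤ bprob p (bx 0 L) (fun ω => Arm 0 m L (fun v => v.1 = L) ω) ∧
        7 / 8 ≤ bprob p (bx 0 L) (fun ω => Arm 0 m L (fun v => v.1 = -L) ω)) ∧
      7 / 8 ≤ bprob p (bx 0 L) (fun ω => Arm 0 m L (fun v => v.2 = L) ω) ∧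
        7 / 8 ≤ bprob p (bx 0 L) (fun ω => Arm 0 m L (fun v => v.2 = -L) ω) := by
  obtain ⟨m, hm⟩ := exists_ball_reach hp hθ h (show (0 : ℝ) < 1 / 4096 by norm_num)
  refine ⟨m, fun L hL => ?_⟩
  have hmono : ∀ Q : Site → Prop, ∀ ω ω' : Finset Site, ω ⊆ ω' →
      Arm 0 m L Q ω → Arm 0 m L Q ω' := fun Q ω ω' hω => Arm.mono (by exact_mod_cast hω)
  have hs := @bprob_arm_symm p (Equiv.prodComm ℤ ℤ) triAdj_swap bx_zero_map_swap m L
  have hn := @bprob_arm_symm p (Equiv.neg Site) triAdj_neg bx_zero_map_neg m L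
  have e1 : bprob p (bx 0 L) (fun ω => Arm 0 m L (fun v => v.1 = -L) ω)
      = bprob p (bx 0 L) (fun ω => Arm 0 m L (fun v => v.1 = L) ω) := by
    simpa using @hn (fun v => v.1 = L) (fun v => v.1 = -L) (fun v => v.1 = L) (fun v => v.1 = -L)
      (fun v => by simp) (fun v => by simp)
  have e2 : bprob p (bx 0 L) (fun ω => Arm 0 m L (fun v => v.2 = L) ω)
      = bprob p (bx 0 L) (fun ω => Arm 0 m L (fun v => v.1 = L) ω) := by
    simpa using @hs (fun v => v.1 = L) (fun v => v.2 = L) (fun v => v.1 = L) (fun v => v.2 = L)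
      (fun v => by simp) (fun v => by simp)
  have e3 : bprob p (bx 0 L) (fun ω => Arm 0 m L (fun v => v.2 = -L) ω)
      = bprob p (bx 0 L) (fun ω => Arm 0 m L (fun v => v.1 = -L) ω) := by
    simpa using @hs (fun v => v.1 = -L) (fun v => v.2 = -L) (fun v => v.1 = -L) (fun v => v.2 = -L)
      (fun v => by simp) (fun v => by simp)
  have e4 := @hs (fun v => v.1 = L) (fun v => v.2 = L) (fun v => v.1 = -L) (fun v => v.2 = -L)
      (fun v => by simp) (fun v => by simp)
  have i1 := bprob_not_mul_not_le hp (bx 0 L) (hmono fun v => v.1 = L) (hmono fun v => v.1 = -L)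
  have i2 := bprob_not_mul_not_le hp (bx 0 L)
    (A := fun ω => Arm 0 m L (fun v => v.1 = L) ω ∨ Arm 0 m L (fun v => v.1 = -L) ω)
    (B := fun ω => Arm 0 m L (fun v => v.2 = L) ω ∨ Arm 0 m L (fun v => v.2 = -L) ω)
    (fun ω ω' hω => Or.imp (hmono _ ω ω' hω) (hmono _ ω ω' hω))
    (fun ω ω' hω => Or.imp (hmono _ ω ω' hω) (hmono _ ω ω' hω))
  have i3 := (hm L hL).trans (bprob_mono hp fun ω _ => exists_arm_of_reach (O := ω) hL)
  have i4 := bprob_le_one hp (bx 0 L)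
    (fun ω => Arm 0 m L (fun v => v.1 = L) ω ∨ Arm 0 m L (fun v => v.1 = -L) ω)
  rw [e1] at i1
  rw [e4] at i2
  rw [e3, e1, e2]
  set a := bprob p (bx 0 L) (fun ω => Arm 0 m L (fun v => v.1 = L) ω)
  set b := bprob p (bx 0 L)
    (fun ω => Arm 0 m L (fun v => v.1 = L) ω ∨ Arm 0 m L (fun v => v.1 = -L) ω)
  have hb : 1 - b ≤ 1 / 64 := abs_le_of_sq_le_sq' (by nlinarith) (by norm_num) |>.2
  have ha : 1 - a ≤ 1 / 8 := abs_le_of_sq_le_sq' (by nlinarith) (by norm_num) |>.2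
  have : 7 / 8 ≤ a := by linarith
  exact ⟨⟨this, this⟩, this, this⟩

lemma fourArm_inter_iff {x : Site} {m L : ℕ} {ω : Finset Site} :
    FourArm x m L ω ↔ FourArm x m L ((ω ∩ bx x L : Finset Site) : Set Site) := by
  have h1 : (ω : Set Site) ∩ bx x L = ((ω ∩ bx x L : Finset Site) : Set Site) ∩ bx x L := by
    ext; simp
  have h2 : (ω : Set Site)ᶜ ∩ bx x L = ((ω ∩ bx x L : Finset Site) : Set Site)ᶜ ∩ bx x L := by
    ext; simp; tauto
  exact and_congr (and_congr (arm_congr h1) (arm_congr h1))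
    (and_congr (arm_congr h2) (arm_congr h2))

lemma exists_half_le_fourArm {p₀ θ : ℝ} (hp₀ : p₀ ∈ Set.Icc (0 : ℝ) 1) (hθ : 0 < θ)
    (h : ∀ n, θ ≤ reachProb p₀ n) : ∃ m : ℕ, ∀ L ≥ m, ∀ p ∈ Set.Icc p₀ (1 - p₀),
      ∀ (x : Site) (Λ : Finset Site), bx x L ⊆ Λ →
        1 / 2 ≤ bprob p Λ fun ω => FourArm x m L ω := by
  obtain ⟨m, hm⟩ := exists_arm_prob hp₀ hθ h
  refine ⟨m, fun L hL p hp x Λ hΛ => ?_⟩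
  have hp' : p ∈ Set.Icc (0 : ℝ) 1 := ⟨hp₀.1.trans hp.1, by linarith [hp.2, hp₀.1]⟩
  have htrans : bprob p Λ (fun ω => FourArm x m L ω)
      = bprob p (bx 0 L) fun ω => FourArm 0 m L ω := by
    rw [bprob_local p hΛ (F := fun ω => FourArm x m L ω) fun ω _ => fourArm_inter_iff]
    have hx : ∀ n, (bx 0 n).map (Equiv.addRight x).toEmbedding = bx x n := fun n => by
      rw [bx_map_addRight, zero_add]
    rw [← hx L, bprob_map]
    refine bexp_congr p fun ω _ => ind_congr ?_
    have key : ∀ (Q : Site → Prop) (O : Set Site),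
        Arm x m L Q (Equiv.addRight x '' O) ↔ Arm 0 m L Q O := fun Q O =>
      arm_map_iff (Equiv.addRight x) (triAdj_addRight x) hx (by simp)
    beta_reduce
    rw [Finset.coe_map, FourArm, FourArm]
    have hc : (⇑(Equiv.addRight x).toEmbedding '' (ω : Set Site))ᶜ
        = Equiv.addRight x '' (ω : Set Site)ᶜ :=
      (Set.image_compl_eq (Equiv.addRight x).bijective).symm
    rw [hc]
    exact and_congr (and_congr (key _ _) (key _ _)) (and_congr (key _ _) (key _ _))
  rw [htrans]
  have hopen : ∀ Q : Site → Prop, 7 / 8 ≤ bprob p₀ (bx 0 L) (fun ω => Arm 0 m L Q ω) →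
      bprob p (bx 0 L) (fun ω => ¬ Arm 0 m L Q ω) ≤ 1 / 8 := fun Q hQ => by
    have := bexp_mono_param hp₀.1 hp.1 hp'.2 (bx 0 L) (ind_monotone (A := fun ω : Finset Site =>
      Arm 0 m L Q ω) fun ω ω' hω => Arm.mono (by exact_mod_cast hω))
    rw [bprob_not p (bx 0 L) fun ω => Arm 0 m L Q ω]
    unfold bprob at hQ ⊢
    linarith
  have hclosed : ∀ Q : Site → Prop, 7 / 8 ≤ bprob p₀ (bx 0 L) (fun ω => Arm 0 m L Q ω) →
      bprob p (bx 0 L) (fun ω => ¬ Arm 0 m L Q (ω : Set Site)ᶜ) ≤ 1 / 8 := fun Q hQ => by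
    have h1 := bexp_mono_param hp₀.1 (show p₀ ≤ 1 - p by linarith [hp.2]) (by linarith [hp'.1])
      (bx 0 L) (ind_monotone (A := fun ω : Finset Site =>
      Arm 0 m L Q ω) fun ω ω' hω => Arm.mono (by exact_mod_cast hω))
    have h2 := bexp_one_sub p (bx 0 L) fun ω : Finset Site => ind (Arm 0 m L Q ω)
    have h3 : bexp p (bx 0 L) (fun ω => ind (Arm 0 m L Q ((bx 0 L \ ω : Finset Site) : Set Site)))
        = bexp p (bx 0 L) (fun ω => ind (Arm 0 m L Q (ω : Set Site)ᶜ)) :=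
      bexp_congr p fun ω _ => ind_congr (arm_congr (by ext; simp; tauto))
    rw [bprob_not p (bx 0 L) fun ω => Arm 0 m L Q (ω : Set Site)ᶜ]
    unfold bprob at hQ ⊢
    linarith
  obtain ⟨⟨g1, g2⟩, g3, g4⟩ := hm L hL
  have b1 := bprob_or_le hp' (bx 0 L) (fun ω => ¬ Arm 0 m L (fun v => v.1 = L) ω)
    (fun ω => ¬ Arm 0 m L (fun v => v.1 = -L) ω)
  have b2 := bprob_or_le hp' (bx 0 L) (fun ω => ¬ Arm 0 m L (fun v => v.2 = L) (ω : Set Site)ᶜ)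
    (fun ω => ¬ Arm 0 m L (fun v => v.2 = -L) (ω : Set Site)ᶜ)
  have b3 := bprob_or_le hp' (bx 0 L) (fun ω =>
    ¬ Arm 0 m L (fun v => v.1 = L) ω ∨ ¬ Arm 0 m L (fun v => v.1 = -L) ω) (fun ω =>
      ¬ Arm 0 m L (fun v => v.2 = L) (ω : Set Site)ᶜ ∨
        ¬ Arm 0 m L (fun v => v.2 = -L) (ω : Set Site)ᶜ)
  have hnot := bprob_mono hp' (Λ := bx 0 L) (A := fun ω => ¬ FourArm 0 m L ω) (B := fun ω =>
    (¬ Arm 0 m L (fun v => v.1 = L) ω ∨ ¬ Arm 0 m L (fun v => v.1 = -L) ω) ∨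
      (¬ Arm 0 m L (fun v => v.2 = L) (ω : Set Site)ᶜ ∨
        ¬ Arm 0 m L (fun v => v.2 = -L) (ω : Set Site)ᶜ)) fun ω _ => by
    unfold FourArm
    tauto
  have c1 := hopen _ g1
  have c2 := hopen _ g2
  have c3 := hclosed _ g3
  have c4 := hclosed _ g4
  rw [bprob_not p (bx 0 L) fun ω => FourArm 0 m L ω] at hnot
  linarith

lemma conn_bx_corner {x u : Site} {m : ℕ} (hu : u ∈ bx x m) :
    Conn (bx x m) u (x.1 + m, x.2 + m) := by
  have h1 : ∀ k : ℕ, u.1 + k ≤ x.1 + m → Conn (bx x m) u (u.1 + k, u.2) := by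
    intro k
    induction k with
    | zero => exact fun _ => by simpa using Conn.refl (O := bx x m) hu
    | succ k ih =>
      intro hk
      push_cast at hk ⊢
      refine (ih (by omega)).step ?_ ?_
      · rw [triAdj_iff]; right; left; exact ⟨by simp only; omega, rfl⟩
      · rw [mem_bx] at hu; rw [Finset.mem_coe, mem_bx]; simp only; omega
  have h2 : ∀ k : ℕ, u.2 + k ≤ x.2 + m → Conn (bx x m) u (x.1 + m, u.2 + k) := by
    intro k
    induction k with
    | zero =>
      intro _
      have h := h1 (x.1 + m - u.1).toNat (by rw [mem_bx] at hu; omega)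
      have e : u.1 + ((x.1 + m - u.1).toNat : ℤ) = x.1 + m := by rw [mem_bx] at hu; omega
      rw [e] at h
      simpa using h
    | succ k ih =>
      intro hk
      push_cast at hk ⊢
      refine (ih (by omega)).step ?_ ?_
      · rw [triAdj_iff]; right; right; right; left; exact ⟨rfl, by simp only; omega⟩
      · rw [mem_bx] at hu; rw [Finset.mem_coe, mem_bx]; simp only; omega
  have h := h2 (x.2 + m - u.2).toNat (by rw [mem_bx] at hu; omega)
  have e : u.2 + ((x.2 + m - u.2).toNat : ℤ) = x.2 + m := by rw [mem_bx] at hu; omega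
  rwa [e] at h

lemma conn_bx {x u v : Site} {m : ℕ} (hu : u ∈ bx x m) (hv : v ∈ bx x m) :
    Conn (bx x m) u v := (conn_bx_corner hu).trans (conn_bx_corner hv).symm

/-- The sites of norm `n`. -/
noncomputable def sphere (n : ℕ) : Finset Site := bx 0 n \ bx 0 (n - 1)

lemma card_bx (x : Site) (n : ℕ) : (bx x n).card = (2 * n + 1) ^ 2 := by
  rw [bx, Finset.card_product, Int.card_Icc, Int.card_Icc, sq]
  congr 1 <;> omega

lemma card_sphere_le (n : ℕ) : (sphere n).card ≤ 8 * n + 1 := by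
  have h : bx 0 (n - 1) ⊆ bx 0 n := bx_subset (by simp) (by simp)
  rw [sphere, Finset.card_sdiff_of_subset h, card_bx, card_bx]
  rcases n with _ | n
  · simp
  · rw [Nat.sub_le_iff_le_add, Nat.add_sub_cancel]
    ring_nf; omega

/-- Two sites of norm `n` are equivalent if they are equal or joined by a path of `O` inside the
ball of radius `n`. -/
def sphereSetoid (n : ℕ) (O : Set Site) : Setoid (sphere n) where
  r u v := u = v ∨ Conn (O ∩ bx 0 n) u v
  iseqv :=
    { refl := fun _ => Or.inl rfl
      symm := Or.imp Eq.symm Conn.symm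
      trans := by
        rintro u v w (rfl | h) (rfl | huw)
        · exact Or.inl rfl
        · exact Or.inr huw
        · exact Or.inr h
        · exact Or.inr (h.trans huw) }

/-- The number of classes of sites of norm `n`. -/
noncomputable def numClasses (n : ℕ) (O : Set Site) : ℕ := Nat.card (Quotient (sphereSetoid n O))

lemma numClasses_le (n : ℕ) (O : Set Site) : numClasses n O ≤ 8 * n + 1 := by
  refine (Nat.card_le_card_of_surjective _ Quotient.mk_surjective).trans ?_
  rw [Nat.card_eq_fintype_card, Fintype.card_coe]
  exact card_sphere_le n

lemma sphereSetoid_le {n : ℕ} {O O' : Set Site} (h : O ⊆ O') :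
    sphereSetoid n O ≤ sphereSetoid n O' := fun _ _ =>
  Or.imp id (Conn.mono (Set.inter_subset_inter_left _ h))

lemma numClasses_antitone (n : ℕ) : Antitone (numClasses n) := fun _ _ h =>
  Nat.card_le_card_of_surjective (Quotient.map id (sphereSetoid_le h))
    (Quotient.ind fun v => ⟨⟦v⟧, rfl⟩)

lemma numClasses_lt {n : ℕ} {O O' : Set Site} (h : O ⊆ O') {u v : Site} (hu : u ∈ sphere n)
    (hv : v ∈ sphere n) (hne : u ≠ v) (hO : ¬ Conn (O ∩ bx 0 n) u v)
    (hO' : Conn (O' ∩ bx 0 n) u v) : numClasses n O' < numClasses n O := by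
  refine lt_of_le_of_ne (numClasses_antitone n h) fun heq => ?_
  have hsurj : Function.Surjective (Quotient.map id (sphereSetoid_le (n := n) h)) :=
    Quotient.ind fun v => ⟨⟦v⟧, rfl⟩
  have hinj := ((Nat.bijective_iff_surjective_and_card _).2 ⟨hsurj, heq.symm⟩).1
  have : (⟦⟨u, hu⟩⟧ : Quotient (sphereSetoid n O)) = ⟦⟨v, hv⟩⟧ :=
    hinj (Quotient.sound (Or.inr hO'))
  rcases Quotient.exact this with h | h
  · exact hne (congrArg Subtype.val h)
  · exact hO h

lemma exists_truncated_arm {O : Set Site} {x u v : Site} {m n L : ℕ} (hm : bx x (m + 1) ⊆ bx 0 n)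
    (hu : u ∈ bx x m) (hv : v ∉ bx 0 n) (huv : Conn (O ∩ bx x L) u v) :
    ∃ a b c, b ∈ bx x m ∧ triAdj a b ∧ c ∈ sphere n ∧
      Conn ((O \ bx x m) ∩ bx 0 n) a c ∧ Conn ((O \ bx x m) ∩ bx x L) a v := by
  have hmm : bx x m ⊆ bx x (m + 1) := bx_subset (by simp) (by simp)
  obtain ⟨a, b, hva, hab, -, hb⟩ := huv.symm.exists_exit (fun w => w ∉ bx x m)
    (fun h => hv (hm (hmm h))) (not_not.2 hu)
  have hb := not_not.1 hb
  have hav : Conn ((O \ bx x m) ∩ bx x L) a v := by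
    refine hva.symm.mono ?_
    rintro w ⟨⟨h1, h2⟩, h3⟩
    exact ⟨⟨h1, h3⟩, h2⟩
  have ha : a ∈ bx 0 n := by
    refine hm ?_
    rw [triAdj_iff] at hab
    rw [mem_bx] at hb ⊢
    push_cast
    omega
  obtain ⟨c, d, hac, hcd, -, hd⟩ := hav.exists_exit (fun w => w ∈ bx 0 n) ha hv
  refine ⟨a, b, c, hb, hab, ?_, hac.mono ?_, hav⟩
  · refine Finset.mem_sdiff.2 ⟨hac.right_mem.2, fun hc => hd ?_⟩
    rw [triAdj_iff] at hcd
    rw [mem_bx] at hc ⊢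
    have hn := mem_bx.1 (hm (show (x.1 + ((m + 1 : ℕ) : ℤ), x.2) ∈ bx x (m + 1) by
      rw [mem_bx]; simp only; omega))
    have hn' := mem_bx.1 (hm (show (x.1 - ((m + 1 : ℕ) : ℤ), x.2) ∈ bx x (m + 1) by
      rw [mem_bx]; simp only; omega))
    simp only [Prod.fst_zero, Prod.snd_zero] at hc hn hn' ⊢
    omega
  · rintro w ⟨⟨h1, -⟩, h2⟩
    exact ⟨h1, h2⟩

lemma numClasses_lt_of_fourArm {ω : Finset Site} {x : Site} {m n L : ℕ}
    (hm : bx x (m + 1) ⊆ bx 0 n) (hL1 : |x.1| + n < L) (hL2 : |x.2| + n ≤ L)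
    (h : FourArm x m L ω) :
    numClasses n ((ω ∪ bx x m : Finset Site) : Set Site)
      < numClasses n ((ω \ bx x m : Finset Site) : Set Site) := by
  obtain ⟨⟨⟨u, hu, v, huv, hv⟩, ⟨u', hu', v', huv', hv'⟩⟩, ⟨w, hw, z, hwz, hz⟩,
    ⟨w', hw', z', hwz', hz'⟩⟩ := h
  have h1 := neg_abs_le x.1
  have h2 := le_abs_self x.1
  have hnL : bx 0 n ⊆ bx x L := bx_subset (by simp; omega) (by simpa using hL2)
  have hmL : bx x m ⊆ bx x L := ((bx_subset (by simp) (by simp)).trans hm).trans hnL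
  simp only [Prod.fst_sub, Prod.snd_sub] at hv hv' hz hz'
  obtain ⟨a, b, c, hb, hab, hc, hac, hav⟩ := exists_truncated_arm hm hu
    (fun h => by rw [mem_bx] at h; simp only [Prod.fst_zero] at h; omega) huv
  obtain ⟨a', b', c', hb', hab', hc', hac', hav'⟩ := exists_truncated_arm hm hu'
    (fun h => by rw [mem_bx] at h; simp only [Prod.fst_zero] at h; omega) huv'
  rw [Finset.coe_union, Finset.coe_sdiff]
  have hsub : ((ω : Set Site) \ bx x m) ∩ bx 0 n ⊆ ((ω : Set Site) ∪ bx x m) ∩ bx 0 n :=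
    Set.inter_subset_inter_left _ (Set.sdiff_subset.trans Set.subset_union_left)
  have hsub' : (bx x m : Set Site) ⊆ ((ω : Set Site) ∪ bx x m) ∩ bx 0 n := fun y hy =>
    ⟨Or.inr hy, hm (bx_subset (m := m + 1) (by simp) (by simp) hy)⟩
  have hsubL : ((ω : Set Site) \ bx x m) ∩ bx 0 n ⊆ ((ω : Set Site) \ bx x m) ∩ bx x L :=
    Set.inter_subset_inter_right _ (by exact_mod_cast hnL)
  have hnot : ∀ hcc' : Conn (((ω : Set Site) \ bx x m) ∩ bx 0 n) c c', False := by
    intro hcc'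
    have hvv' : Conn (((ω : Set Site) \ bx x m) ∩ bx x L) v' v :=
      hav'.symm.trans (((hac.trans hcc').trans hac'.symm).symm.mono hsubL |>.trans hav)
    have hCsub : (ω : Set Site)ᶜ ∩ bx x L ⊆ ((ω : Set Site)ᶜ ∪ bx x m) ∩ bx x L :=
      Set.inter_subset_inter_left _ Set.subset_union_left
    have hBsub : (bx x m : Set Site) ⊆ ((ω : Set Site)ᶜ ∪ bx x m) ∩ bx x L := fun y hy =>
      ⟨Or.inr hy, hmL hy⟩
    have hzz' : Conn (((ω : Set Site)ᶜ ∪ bx x m) ∩ bx x L) z' z :=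
      (hwz'.mono hCsub).symm.trans (((conn_bx hw' hw).mono hBsub).trans (hwz.mono hCsub))
    refine not_disjoint_crossings (l := x.1 - L) (r := x.1 + L) (b := x.2 - L) (t := x.2 + L)
      (Set.disjoint_left.2 ?_) (fun y hy => ?_) (fun y hy => ?_) hvv' hzz'
      (by omega) (by omega) (by omega) (by omega)
    · rintro y ⟨⟨h3, h4⟩, -⟩ ⟨h5 | h5, -⟩
      · exact h5 h3
      · exact h4 h5
    · exact (mem_bx.1 hy.2).2
    · exact (mem_bx.1 hy.2).1
  refine numClasses_lt (Set.sdiff_subset.trans Set.subset_union_left) hc hc'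
    (fun hcc => hnot (hcc ▸ Conn.refl hac.right_mem)) hnot ?_
  refine (hac.symm.mono hsub).trans (Conn.trans ?_ (hac'.mono hsub))
  exact (((Conn.refl (hsub hac.left_mem)).step hab (hsub' hb)).trans
    ((conn_bx hb hb').mono hsub')).step (triAdj_symm hab') (hsub hac'.left_mem)

lemma card_sq_mul_le_sum_pivotal {m K : ℕ} {p₀ p : ℝ} (hp₀ : 0 ≤ p₀)
    (hp : p ∈ Set.Icc p₀ (1 - p₀))
    (h : ∀ x Λ, bx x (2 * ((2 * m + 1) * K)) ⊆ Λ →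
      1 / 2 ≤ bprob p Λ fun ω => FourArm x m (2 * ((2 * m + 1) * K)) ω) :
    (K : ℝ) ^ 2 * (p₀ ^ (2 * m + 1) ^ 2 / 2)
      ≤ ∑ v ∈ bx 0 (3 * ((2 * m + 1) * K)), bexp p (bx 0 (3 * ((2 * m + 1) * K)))
        (fun ω => (numClasses ((2 * m + 1) * K) (ω.erase v : Finset Site) : ℝ)
          - numClasses ((2 * m + 1) * K) (insert v ω : Finset Site)) := by
  set n := (2 * m + 1) * K with hn
  set Λ := bx 0 (3 * n) with hΛ
  set f : Finset Site → ℝ := fun ω => (numClasses n ω : ℝ) with hf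
  have hp' : p ∈ Set.Icc (0 : ℝ) 1 := ⟨hp₀.trans hp.1, by linarith [hp.2]⟩
  have hanti : Antitone f := fun ω ω' hω => by
    simp only [hf]
    exact_mod_cast numClasses_antitone n (by exact_mod_cast hω)
  let ctr : ℕ × ℕ → Site := fun q =>
    ((((2 * m + 1) * q.1 : ℕ) : ℤ), (((2 * m + 1) * q.2 : ℕ) : ℤ))
  have hctr : ∀ i < K, (2 * m + 1) * i + (2 * m + 1) ≤ n := fun i hi => by
    rw [hn, ← Nat.mul_succ]; exact Nat.mul_le_mul_left _ hi
  have hsub : ∀ q ∈ Finset.range K ×ˢ Finset.range K, bx (ctr q) m ⊆ Λ := by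
    intro q hq
    rw [Finset.mem_product, Finset.mem_range, Finset.mem_range] at hq
    have h1 := hctr _ hq.1
    have h2 := hctr _ hq.2
    refine bx_subset ?_ ?_ <;> simp only [ctr, Prod.fst_zero, Prod.snd_zero, sub_zero, Nat.abs_cast]
      <;> omega
  have hone : ∀ q ∈ Finset.range K ×ˢ Finset.range K, p₀ ^ (2 * m + 1) ^ 2 / 2
      ≤ ∑ v ∈ bx (ctr q) m, bexp p Λ (fun ω => f (ω.erase v) - f (insert v ω)) := by
    intro q hq
    have hBΛ := hsub q hq
    rw [Finset.mem_product, Finset.mem_range, Finset.mem_range] at hq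
    have h1 := hctr _ hq.1
    have h2 := hctr _ hq.2
    have hL : bx (ctr q) (2 * n) ⊆ Λ := by
      refine bx_subset ?_ ?_ <;>
        simp only [ctr, Prod.fst_zero, Prod.snd_zero, sub_zero, Nat.abs_cast] <;> omega
    have hm : bx (ctr q) (m + 1) ⊆ bx 0 n := by
      refine bx_subset ?_ ?_ <;>
        simp only [ctr, Prod.fst_zero, Prod.snd_zero, sub_zero, Nat.abs_cast] <;> omega
    have h3 : 1 / 2 ≤ bexp p Λ (fun ω => f (ω \ bx (ctr q) m) - f (ω ∪ bx (ctr q) m)) := by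
      refine (h (ctr q) Λ hL).trans (bexp_mono hp' fun ω _ => ?_)
      by_cases hF : FourArm (ctr q) m (2 * n) ω
      · rw [ind_true hF]
        have h4 := numClasses_lt_of_fourArm hm
          (by simp only [ctr, Nat.abs_cast]; omega) (by simp only [ctr, Nat.abs_cast]; omega) hF
        have h5 : (numClasses n (ω ∪ bx (ctr q) m : Finset Site) : ℝ) + 1
          ≤ numClasses n (ω \ bx (ctr q) m : Finset Site) := by exact_mod_cast h4
        simp only [hf]
        linarith
      · rw [ind_false hF, sub_nonneg]
        exact hanti (Finset.sdiff_subset.trans Finset.subset_union_left)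
    have h4 := bexp_switch_le hp' hp₀ hp.1 (by linarith [hp.2]) Λ hanti _ hBΛ
    rw [card_bx] at h4
    refine le_trans ?_ h4
    rw [div_eq_mul_one_div]
    exact mul_le_mul_of_nonneg_left h3 (by positivity)
  have hdisj : ((Finset.range K ×ˢ Finset.range K : Finset (ℕ × ℕ)) : Set (ℕ × ℕ)).PairwiseDisjoint
      fun q => bx (ctr q) m := by
    have key : ∀ i j : ℕ, i < j → (2 * m + 1) * i + (2 * m + 1) ≤ (2 * m + 1) * j := by
      intro i j hij
      rw [← Nat.mul_succ]; exact Nat.mul_le_mul_left _ hij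
    intro q _ q' _ hne
    refine Finset.disjoint_left.2 fun v hv hv' => hne ?_
    simp only [mem_bx, ctr] at hv hv'
    refine Prod.ext ?_ ?_
    · rcases lt_trichotomy q.1 q'.1 with h | h | h
      · have := key _ _ h; omega
      · exact h
      · have := key _ _ h; omega
    · rcases lt_trichotomy q.2 q'.2 with h | h | h
      · have := key _ _ h; omega
      · exact h
      · have := key _ _ h; omega
  calc (K : ℝ) ^ 2 * (p₀ ^ (2 * m + 1) ^ 2 / 2)
      = ∑ _q ∈ Finset.range K ×ˢ Finset.range K, p₀ ^ (2 * m + 1) ^ 2 / 2 := by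
        rw [Finset.sum_const, Finset.card_product, Finset.card_range, nsmul_eq_mul, sq]
        push_cast; rfl
    _ ≤ ∑ q ∈ Finset.range K ×ˢ Finset.range K, ∑ v ∈ bx (ctr q) m,
          bexp p Λ (fun ω => f (ω.erase v) - f (insert v ω)) := Finset.sum_le_sum hone
    _ = ∑ v ∈ (Finset.range K ×ˢ Finset.range K).biUnion fun q => bx (ctr q) m,
          bexp p Λ (fun ω => f (ω.erase v) - f (insert v ω)) := (Finset.sum_biUnion hdisj).symm
    _ ≤ _ := Finset.sum_le_sum_of_subset_of_nonneg (Finset.biUnion_subset.2 hsub)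
        fun v _ _ => bexp_nonneg hp' fun ω _ => sub_nonneg.2
          (hanti ((Finset.erase_subset v ω).trans (Finset.subset_insert v ω)))

lemma exists_reachProb_lt_of_pos {p θ : ℝ} (hp : 0 < p) (hp2 : p < 1 / 2) (hθ : 0 < θ) :
    ∃ n, reachProb p n < θ := by
  by_contra! h
  obtain ⟨m, hm⟩ := exists_half_le_fourArm ⟨hp.le, by linarith⟩ hθ h
  set c := (p ^ (2 * m + 1) ^ 2 / 2) * (1 - 2 * p) with hc
  have hc0 : 0 < c := mul_pos (by positivity) (by linarith)
  obtain ⟨K, hK⟩ := exists_nat_gt (9 * (2 * m + 1) / c)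
  have hK0 : 0 < K := by
    have : (0 : ℝ) < K := lt_of_le_of_lt (by positivity) hK
    exact_mod_cast this
  set n := (2 * m + 1) * K with hn
  have hnm : m ≤ 2 * n := by
    have : (2 * m + 1) * 1 ≤ n := Nat.mul_le_mul_left _ hK0
    omega
  set f : Finset Site → ℝ := fun ω => (numClasses n ω : ℝ) with hf
  obtain ⟨q, hq, hq'⟩ := exists_hasDerivAt_eq_slope (fun q => bexp q (bx 0 (3 * n)) f) _
    (show p < 1 - p by linarith)
    (fun q _ => (hasDerivAt_bexp q _ f).continuousAt.continuousWithinAt)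
    (fun q _ => hasDerivAt_bexp q _ f)
  have h1 := card_sq_mul_le_sum_pivotal (m := m) (K := K) hp.le (Set.Ioo_subset_Icc_self hq)
    fun x Λ => hm (2 * n) hnm q (Set.Ioo_subset_Icc_self hq) x Λ
  have h2 : bexp p (bx 0 (3 * n)) f ≤ 8 * n + 1 := by
    rw [← bexp_const p (bx 0 (3 * n)) (8 * n + 1)]
    exact bexp_mono ⟨hp.le, by linarith⟩ fun ω _ => by
      simp only [hf]
      exact_mod_cast numClasses_le n ω
  have h3 : 0 ≤ bexp (1 - p) (bx 0 (3 * n)) f :=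
    bexp_nonneg ⟨by linarith, by linarith⟩ fun ω _ => Nat.cast_nonneg _
  have h4 : ∑ v ∈ bx 0 (3 * n), bexp q (bx 0 (3 * n)) (fun ω => f (insert v ω) - f (ω.erase v))
      = - ∑ v ∈ bx 0 (3 * n), bexp q (bx 0 (3 * n))
        (fun ω => f (ω.erase v) - f (insert v ω)) := by
    rw [← Finset.sum_neg_distrib]
    refine Finset.sum_congr rfl fun v _ => ?_
    rw [bexp_sub q _ (fun ω => f (insert v ω)), bexp_sub q _ (fun ω => f (ω.erase v)), neg_sub]
  rw [h4, eq_div_iff (by linarith)] at hq'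
  have h5 : (K : ℝ) ^ 2 * c ≤ 8 * n + 1 := by
    have := mul_le_mul_of_nonneg_right h1 (show 0 ≤ 1 - 2 * p by linarith)
    rw [hc, ← mul_assoc]
    simp only [hf] at hq' h2 h3
    linarith
  have h6 : (n : ℝ) = (2 * m + 1) * K := by rw [hn]; push_cast; ring
  have hK1 : (1 : ℝ) ≤ K := by exact_mod_cast hK0
  rw [div_lt_iff₀ hc0] at hK
  have h7 : 9 * (2 * (m : ℝ) + 1) * K < K ^ 2 * c := by
    have := mul_lt_mul_of_pos_right hK (show (0 : ℝ) < K by linarith)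
    linarith
  have h8 : (1 : ℝ) ≤ (2 * m + 1) * K := by
    have : (1 : ℝ) ≤ 2 * m + 1 := by linarith [(Nat.cast_nonneg m : (0 : ℝ) ≤ m)]
    exact one_le_mul_of_one_le_of_one_le this hK1
  rw [h6] at h5
  linarith

lemma reachProb_mono {p q : ℝ} (hp : 0 ≤ p) (hpq : p ≤ q) (hq : q ≤ 1) (n : ℕ) :
    reachProb p n ≤ reachProb q n :=
  bexp_mono_param hp hpq hq _ (ind_monotone fun _ _ hω => Reach.mono (by exact_mod_cast hω))

/-- Below `1 / 2` the origin is joined to distance `n` with probability tending to zero. -/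
theorem exists_reachProb_lt {p θ : ℝ} (hp : 0 ≤ p) (hp2 : p < 1 / 2) (hθ : 0 < θ) :
    ∃ n, reachProb p n < θ := by
  obtain ⟨q, hpq, hq⟩ := exists_between hp2
  obtain ⟨n, hn⟩ := exists_reachProb_lt_of_pos (hp.trans_lt hpq) hq hθ
  exact ⟨n, (reachProb_mono hp hpq.le (by linarith) n).trans_lt hn⟩

lemma measure_infinite_eq_zero {p : ℝ} (hp : 0 ≤ p) (hp2 : p < 1 / 2) {μ : Measure Config}
    (hμ : IsBernoulliPercolation p μ) : μ {ω | (openCluster ω (0, 0)).Infinite} = 0 := by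
  refine le_antisymm (ENNReal.le_of_forall_pos_le_add fun θ hθ _ => ?_) zero_le
  obtain ⟨n, hn⟩ := exists_reachProb_lt hp hp2 (NNReal.coe_pos.2 hθ)
  rw [zero_add]
  refine (measure_infinite_le ⟨hp, by linarith⟩ hμ n).trans ?_
  exact ENNReal.ofReal_le_of_le_toReal hn.le

/-- The critical probability of the triangular lattice is `1 / 2`. -/
theorem pcSite_eq_half : pcSite = 1 / 2 := by
  refine csSup_eq_of_forall_le_of_forall_lt_exists_gt ?_ (fun p hp => ?_) fun w hw => ?_
  · refine ⟨0, by norm_num, fun μ hμ => ?_⟩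
    exact measure_infinite_eq_zero le_rfl (by norm_num) hμ
  · exact pcSite_le_half_of_mem hp.1 hp.2
  · obtain ⟨p, hp, hp2⟩ := exists_between (max_lt hw (show (0 : ℝ) < 1 / 2 by norm_num))
    have hp0 : 0 ≤ p := (le_max_right _ _).trans hp.le
    exact ⟨p, ⟨⟨hp0, by linarith⟩, fun μ hμ => measure_infinite_eq_zero hp0 hp2 hμ⟩,
      (le_max_left _ _).trans_lt hp⟩

end TriPerc

/-- Proposition 2: for symmetric noise `ε` satisfying assumption `⟨A⟩`, the
threshold `θ = 1/2` satisfies both key inequalities on the triangular lattice: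
`P(ε ≥ 1/2) < p_c^site(𝕋²)` and `p_c^site(𝕋²) < P(1 + ε ≥ 1/2)`. -/
theorem threshold_half_works {Ω : Type*} [MeasurableSpace Ω] (P : Measure Ω) [IsProbabilityMeasure P]
    (ε : Ω → ℝ) (hmeas : Measurable ε)
    (hsym : P.map ε = P.map (fun x => -ε x))
    (hA : ∀ a b C : ℝ, (∀ t ∈ Set.Ioo a b, (P {x | ε x ≤ t}).toReal = C) → b - a < 1) :
    (P {x | (1 : ℝ) / 2 ≤ ε x}).toReal < pcSite ∧
      pcSite < (P {x | (1 : ℝ) / 2 ≤ 1 + ε x}).toReal := by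
  have hIci : P {x | (1 : ℝ) / 2 ≤ ε x} = P {x | ε x ≤ -(1 / 2)} := by
    have h : P.map ε (Set.Ici (1 / 2)) = P.map (fun x => -ε x) (Set.Ici (1 / 2)) := by rw [hsym]
    rw [Measure.map_apply hmeas measurableSet_Ici,
      Measure.map_apply (f := fun x => -ε x) hmeas.neg measurableSet_Ici] at h
    refine h.trans (congrArg P (Set.ext fun x => ?_))
    exact le_neg (a := (1 / 2 : ℝ)) (b := ε x)
  have hpos : 0 < (P {x | -(1 / 2) < ε x ∧ ε x < 1 / 2}).toReal := by
    rw [ENNReal.toReal_pos_iff]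
    refine ⟨pos_iff_ne_zero.2 fun h0 => ?_, measure_lt_top P _⟩
    have h := hA (-(1 / 2)) (1 / 2) (P {x | ε x ≤ -(1 / 2)}).toReal fun t ht => by
      congr 1
      refine le_antisymm ?_ (measure_mono fun x (hx : ε x ≤ _) => hx.trans ht.1.le)
      calc P {x | ε x ≤ t}
          ≤ P ({x | ε x ≤ -(1 / 2)} ∪ {x | -(1 / 2) < ε x ∧ ε x < 1 / 2}) :=
            measure_mono fun x (hx : ε x ≤ t) => (le_or_gt (ε x) (-(1 / 2))).imp id
              fun h => ⟨h, hx.trans_lt ht.2⟩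
        _ ≤ _ := measure_union_le _ _
        _ = P {x | ε x ≤ -(1 / 2)} := by rw [h0, add_zero]
    norm_num at h
  have hcompl : P.real {x | ε x ≤ -(1 / 2)}ᶜ = 1 - P.real {x | ε x ≤ -(1 / 2)} :=
    probReal_compl_eq_one_sub (hmeas measurableSet_Iic)
  have hunion : P.real ({x | -(1 / 2) < ε x ∧ ε x < 1 / 2} ∪ {x | (1 : ℝ) / 2 ≤ ε x})
      = P.real {x | -(1 / 2) < ε x ∧ ε x < 1 / 2} + P.real {x | (1 : ℝ) / 2 ≤ ε x} :=
    measureReal_union (Set.disjoint_left.2 fun x hx (hx' : 1 / 2 ≤ ε x) => hx.2.not_ge hx')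
      (hmeas measurableSet_Ici)
  have hle : P.real ({x | -(1 / 2) < ε x ∧ ε x < 1 / 2} ∪ {x | (1 : ℝ) / 2 ≤ ε x})
      ≤ P.real {x | ε x ≤ -(1 / 2)}ᶜ := by
    refine measureReal_mono ?_
    rintro x (hx | hx) (hx' : ε x ≤ _)
    · exact hx.1.not_ge hx'
    · have : 1 / 2 ≤ ε x := hx
      linarith
  have hge : P.real {x | ε x ≤ -(1 / 2)}ᶜ ≤ P.real {x | (1 : ℝ) / 2 ≤ 1 + ε x} := by
    refine measureReal_mono fun x hx => ?_
    have : -(1 / 2) < ε x := not_le.1 hx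
    show (1 : ℝ) / 2 ≤ 1 + ε x
    linarith
  rw [TriPerc.pcSite_eq_half, hIci]
  have hIci' : P.real {x | (1 : ℝ) / 2 ≤ ε x} = P.real {x | ε x ≤ -(1 / 2)} :=
    congrArg ENNReal.toReal hIci
  simp only [← measureReal_def] at hpos ⊢
  constructor <;> linarith
end

section
/- For every n ∈ ℕ and every configuration ω : {0,…,n}² → {open, closed}, exactly one of the following two statements holds: (i) there is a path of open vertices inside the box [0,n]² (with the triangular-lattice adjacency) joining some vertex of the left side {0}×{0,…,n} to some vertex of the right side {n}×{0,…,n}; (ii) there is a path of closed vertices inside the box joining some vertex of the top side {0,…,n}×{n} to some vertex of the bottom side {0,…,n}×{0}. In particular, the events A_n and B_n are complementary: A_n ∪ B_n is everything and A_n ∩ B_n = ∅. -/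
open MeasureTheory

theorem triAdj_iff {u v : Site} :
    triAdj u v ↔
      (u.1 = v.1 + 1 ∧ u.2 = v.2) ∨ (u.1 = v.1 - 1 ∧ u.2 = v.2) ∨
      (u.1 = v.1 ∧ u.2 = v.2 + 1) ∨ (u.1 = v.1 ∧ u.2 = v.2 - 1) ∨
      (u.1 = v.1 + 1 ∧ u.2 = v.2 + 1) ∨ (u.1 = v.1 - 1 ∧ u.2 = v.2 - 1) := by
  obtain ⟨a, b⟩ := u
  obtain ⟨c, d⟩ := v
  simp only [triAdj, Set.mem_insert_iff, Set.mem_singleton_iff, Prod.mk_sub_mk, Prod.mk.injEq]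
  omega

/-- `v` is joined to a site satisfying `P` by a path of colour `b` inside `[0, n]²`. -/
def ReachableFrom (n : ℕ) (b : Bool) (ω : Config) (P : Site → Prop) (v : Site) : Prop :=
  ∃ l : List Site, l.IsChain triAdj ∧ (∀ w ∈ l, w ∈ box n ∧ ω w = b) ∧
    (∃ u, l.head? = some u ∧ P u) ∧ l.getLast? = some v

namespace ReachableFrom

variable {n : ℕ} {b : Bool} {ω : Config} {P : Site → Prop} {u v : Site}

theorem of_pred (hv : v ∈ box n) (hb : ω v = b) (hP : P v) : ReachableFrom n b ω P v :=
  ⟨[v], by simp, by simp [hv, hb], ⟨v, by simp, hP⟩, by simp⟩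

theorem mem_box (h : ReachableFrom n b ω P v) : v ∈ box n := by
  obtain ⟨l, -, hl, -, hlast⟩ := h
  exact (hl v (List.mem_of_getLast? hlast)).1

theorem color_eq (h : ReachableFrom n b ω P v) : ω v = b := by
  obtain ⟨l, -, hl, -, hlast⟩ := h
  exact (hl v (List.mem_of_getLast? hlast)).2

theorem step (h : ReachableFrom n b ω P u) (huv : triAdj u v) (hv : v ∈ box n) (hb : ω v = b) :
    ReachableFrom n b ω P v := by
  obtain ⟨l, hc, hl, ⟨s, hs, hP⟩, hlast⟩ := h
  refine ⟨l ++ [v], ?_, ?_, ⟨s, ?_, hP⟩, by simp⟩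
  · refine List.isChain_append.2 ⟨hc, by simp, ?_⟩
    simp [hlast, huv]
  · intro w hw
    rcases List.mem_append.1 hw with hw | hw
    · exact hl w hw
    · obtain rfl := List.mem_singleton.1 hw
      exact ⟨hv, hb⟩
  · simp [List.head?_append, hs]

end ReachableFrom

section Existence

open Classical in
/-- The indicator, modulo two, that an edge joins `L` to `C`. -/
noncomputable def interfaceEdge (L C : Site → Prop) (u v : Site) : ZMod 2 :=
  if (L u ∧ C v) ∨ (C u ∧ L v) then 1 else 0

/-- If every vertex of a triangle having an interface edge lies in `L` or in `C`, then the
triangle has an even number of interface edges. -/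
theorem interfaceEdge_triangle {L C : Site → Prop} (hLC : ∀ v, L v → ¬ C v) {x y z : Site}
    (hz : L x ∧ C y ∨ C x ∧ L y → L z ∨ C z) (hx : L y ∧ C z ∨ C y ∧ L z → L x ∨ C x)
    (hy : L x ∧ C z ∨ C x ∧ L z → L y ∨ C y) :
    interfaceEdge L C x y + interfaceEdge L C y z + interfaceEdge L C x z = 0 := by
  have h1 := hLC x
  have h2 := hLC y
  have h3 := hLC z
  have h11 : (1 : ZMod 2) + 1 = 0 := by decide
  unfold interfaceEdge
  by_cases a : L x <;> by_cases b : L y <;> by_cases c : L z <;>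
    by_cases d : C x <;> by_cases e : C y <;> by_cases f : C z <;> simp_all

theorem interfaceEdge_eq_sub {L C : Site → Prop} [DecidablePred L]
    (hLC : ∀ v, L v → ¬ C v) {u v : Site} (hu : L v → L u ∨ C u) (hv : L u → L v ∨ C v) :
    interfaceEdge L C u v = (if L v then 1 else 0) - (if L u then 1 else 0) := by
  have h1 := hLC u
  have h2 := hLC v
  have hneg : (-1 : ZMod 2) = 1 := by decide
  unfold interfaceEdge
  by_cases p : L u <;> by_cases q : L v <;> simp_all

/-- If the edge weights around each unit square sum to zero and vanish on the vertical sides of a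
rectangle, then the bottom and top rows have the same total weight. -/
theorem sum_range_eq_of_square {h v : ℤ → ℤ → ZMod 2} {a : ℤ} {m k : ℕ}
    (hsq : ∀ i < m, ∀ j : ℕ, j < k →
      h (a + i) j + h (a + i) (j + 1) = v (a + i) j + v (a + i + 1) j)
    (hl : ∀ j : ℕ, j < k → v a j = 0)
    (hr : ∀ j : ℕ, j < k → v (a + m) j = 0) :
    ∑ i ∈ Finset.range m, h (a + i) 0 = ∑ i ∈ Finset.range m, h (a + i) k := by
  have hself : ∀ t : ZMod 2, t + t = 0 := by decide
  have key : ∀ j : ℕ, j < k → ∀ p ≤ m,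
      ∑ i ∈ Finset.range p, (h (a + i) j + h (a + i) (j + 1)) = v (a + p) j := by
    intro j hj p hp
    induction p with
    | zero => simpa using (hl j hj).symm
    | succ p ih =>
      rw [Finset.sum_range_succ, ih (by omega),
        hsq p hp j hj, ← add_assoc, hself, zero_add]
      push_cast
      rw [add_assoc]
  have main : ∀ j : ℕ, j ≤ k →
      ∑ i ∈ Finset.range m, h (a + i) 0 = ∑ i ∈ Finset.range m, h (a + i) j := by
    intro j hj
    induction j with
    | zero => simp
    | succ j ih =>
      rw [ih (by omega)]
      have := key j (by omega) m le_rfl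
      rw [hr j hj, Finset.sum_add_distrib] at this
      push_cast
      linear_combination this - hself (∑ i ∈ Finset.range m, h (a + i) (j + 1))
  exact main k le_rfl

theorem exists_crossing (n : ℕ) (ω : Config) : ω ∈ EventA n ∨ ω ∈ EventB n := by
  by_contra hcon
  rw [not_or] at hcon
  obtain ⟨hA, hB⟩ := hcon
  set R : Site → Prop := ReachableFrom n true ω (fun u => u.1 = 0)
  set C : Site → Prop := ReachableFrom n false ω (fun u => u.2 = n)
  set L : Site → Prop := fun v => v.1 < 0 ∨ R v
  have hRn : ∀ v, R v → v.1 ≠ n := by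
    rintro v ⟨l, h1, h2, h3, h4⟩ hv
    exact hA ⟨l, h1, h2, h3, v, h4, hv⟩
  have hC0 : ∀ v, C v → v.2 ≠ 0 := by
    rintro v ⟨l, h1, h2, h3, h4⟩ hv
    exact hB ⟨l, h1, h2, h3, v, h4, hv⟩
  have hLC : ∀ v, L v → ¬ C v := by
    rintro v (hv | hv) hc
    · have := hc.mem_box.1
      omega
    · have h1 := hv.color_eq
      have h2 := hc.color_eq
      simp_all
  have hLn : ∀ v, L v → v.1 < n := by
    rintro v (hv | hv)
    · omega
    · have := hv.mem_box.2.1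
      have := hRn v hv
      omega
  have hclosed : ∀ a c, L a → triAdj a c → 0 ≤ c.2 → c.2 ≤ n → ¬ L c →
      c ∈ box n ∧ ω c = false := by
    intro a c ha hac h0 h1 hc
    have han := hLn a ha
    have hc' : ¬ c.1 < 0 := fun h => hc (Or.inl h)
    have hadj := triAdj_iff.1 hac
    have hbox : c ∈ box n := ⟨by omega, by omega, h0, h1⟩
    refine ⟨hbox, ?_⟩
    by_contra hω
    have hω : ω c = true := by simpa using hω
    rcases ha with ha | ha
    · exact hc (Or.inr (ReachableFrom.of_pred hbox hω (by omega)))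
    · exact hc (Or.inr (ha.step hac hbox hω))
  have hthird : ∀ a b c, L a → C b → triAdj a c → triAdj b c → 0 ≤ c.2 → c.2 ≤ n →
      L c ∨ C c := by
    intro a b c ha hb hac hbc h0 h1
    by_cases hc : L c
    · exact Or.inl hc
    · obtain ⟨hbox, hω⟩ := hclosed a c ha hac h0 h1 hc
      exact Or.inr (hb.step hbc hbox hω)
  have hsymm : ∀ {a b}, triAdj a b → triAdj b a := by
    intro a b h
    rw [triAdj_iff] at h ⊢
    omega
  have htri : ∀ x y z, triAdj x y → triAdj y z → triAdj x z → (0 ≤ x.2 ∧ x.2 ≤ n) →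
      (0 ≤ y.2 ∧ y.2 ≤ n) → (0 ≤ z.2 ∧ z.2 ≤ n) →
      interfaceEdge L C x y + interfaceEdge L C y z + interfaceEdge L C x z = 0 := by
    intro x y z hxy hyz hxz hx hy hz
    refine interfaceEdge_triangle hLC ?_ ?_ ?_
    · rintro (⟨h, h'⟩ | ⟨h, h'⟩)
      · exact hthird _ _ _ h h' hxz hyz hz.1 hz.2
      · exact hthird _ _ _ h' h hyz hxz hz.1 hz.2
    · rintro (⟨h, h'⟩ | ⟨h, h'⟩)
      · exact hthird _ _ _ h h' (hsymm hxy) (hsymm hxz) hx.1 hx.2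
      · exact hthird _ _ _ h' h (hsymm hxz) (hsymm hxy) hx.1 hx.2
    · rintro (⟨h, h'⟩ | ⟨h, h'⟩)
      · exact hthird _ _ _ h h' hxy (hsymm hyz) hy.1 hy.2
      · exact hthird _ _ _ h' h (hsymm hyz) hxy hy.1 hy.2
  have hrows := sum_range_eq_of_square
    (h := fun i j => interfaceEdge L C (i, j) (i + 1, j))
    (v := fun i j => interfaceEdge L C (i, j) (i, j + 1)) (a := -1) (m := n + 2) (k := n)
    (by
      intro i _ j hj
      generalize (-1 + (i : ℤ)) = c
      have h0 : (0 : ℤ) ≤ j := by omega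
      have t1 := htri (c, j) (c + 1, j) (c + 1, j + 1) (triAdj_iff.2 (by simp))
        (triAdj_iff.2 (by simp)) (triAdj_iff.2 (by simp)) ⟨h0, by simp only; omega⟩
        ⟨h0, by simp only; omega⟩ ⟨by simp only; omega, by simp only; omega⟩
      have t2 := htri (c, j) (c, j + 1) (c + 1, j + 1) (triAdj_iff.2 (by simp))
        (triAdj_iff.2 (by simp)) (triAdj_iff.2 (by simp)) ⟨h0, by simp only; omega⟩
        ⟨by simp only; omega, by simp only; omega⟩ ⟨by simp only; omega, by simp only; omega⟩
      have hself : ∀ a : ZMod 2, 2 * a = 0 := by decide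
      linear_combination t1 + t2 - hself (interfaceEdge L C (c, j) (c + 1, j + 1)
        + interfaceEdge L C (c, j) (c, j + 1) + interfaceEdge L C (c + 1, j) (c + 1, j + 1))) (by
      intro j _
      refine if_neg ?_
      rintro (⟨-, h⟩ | ⟨h, -⟩) <;> exact absurd h.mem_box.1 (by norm_num)) (by
      intro j _
      refine if_neg ?_
      rintro (⟨-, h⟩ | ⟨h, -⟩) <;> exact absurd h.mem_box.2.1 (by push_cast; omega))
  have hbot : ∑ i ∈ Finset.range (n + 2),
      interfaceEdge L C (-1 + (i : ℤ), 0) (-1 + (i : ℤ) + 1, 0) = 0 := by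
    refine Finset.sum_eq_zero fun i _ => if_neg ?_
    rintro (⟨-, h⟩ | ⟨h, -⟩) <;> exact hC0 _ h rfl
  have htop : ∑ i ∈ Finset.range (n + 2),
      interfaceEdge L C (-1 + (i : ℤ), n) (-1 + (i : ℤ) + 1, n) = 1 := by
    have : DecidablePred L := Classical.decPred L
    have hstep : ∀ a c, L a → triAdj a c → c.2 = n → ¬ L c → C c := by
      intro a c ha hac hcn hc
      obtain ⟨hbox, hω⟩ := hclosed a c ha hac (by omega) (by omega) hc
      exact ReachableFrom.of_pred hbox hω hcn
    have hedge : ∀ i : ℤ, interfaceEdge L C (i, n) (i + 1, n) =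
        (if L (i + 1, n) then 1 else 0) - (if L (i, n) then 1 else 0) := by
      intro i
      have hadj : triAdj (i, (n : ℤ)) (i + 1, n) := triAdj_iff.2 (by simp)
      exact interfaceEdge_eq_sub hLC
        (fun h => or_iff_not_imp_left.2 (hstep (i + 1, n) (i, n) h (hsymm hadj) rfl))
        (fun h => or_iff_not_imp_left.2 (hstep (i, n) (i + 1, n) h hadj rfl))
    have hsum := Finset.sum_range_sub
      (fun i : ℕ => if L (-1 + (i : ℤ), n) then (1 : ZMod 2) else 0) (n + 2)
    have hl : L (-1 + ((0 : ℕ) : ℤ), n) := Or.inl (by norm_num)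
    have hr : ¬ L (-1 + ((n + 2 : ℕ) : ℤ), n) := fun h => by
      have := hLn _ h
      push_cast at this
      omega
    simp only [if_pos hl, if_neg hr] at hsum
    calc _ = _ := Finset.sum_congr rfl fun i _ => by
            rw [hedge]
            push_cast
            rw [add_assoc]
      _ = _ := hsum
      _ = 1 := by decide
  rw [hbot, htop] at hrows
  exact absurd hrows (by decide)

end Existence

section Uniqueness

/-- The indicator, modulo two, that an edge leaves column `x.1` to the right, its left endpoint
lying strictly below `x`. -/
def edgeBelow (x u v : Site) : ZMod 2 :=
  if (u.1 = x.1 ∧ v.1 = x.1 + 1 ∧ u.2 < x.2) ∨ (v.1 = x.1 ∧ u.1 = x.1 + 1 ∧ v.2 < x.2) then 1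
  else 0

/-- The number, modulo two, of edges of a path passing below `x`, when the path is
extended by one more edge to the right of its last site. -/
def passesBelow (x : Site) : List Site → ZMod 2
  | [] => 0
  | [e] => if e.1 = x.1 ∧ e.2 < x.2 then 1 else 0
  | u :: v :: t => edgeBelow x u v + passesBelow x (v :: t)

theorem passesBelow_eq_zero {x : Site} : ∀ {l : List Site}, (∀ v ∈ l, x.2 ≤ v.2) →
    passesBelow x l = 0
  | [], _ => rfl
  | [e], h => if_neg fun h' => by
      have := h e (by simp)
      omega
  | u :: v :: t, h => by
      have hu := h u (by simp)
      have hv := h v (by simp)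
      rw [passesBelow, passesBelow_eq_zero fun w hw => h w (List.mem_cons_of_mem _ hw),
        edgeBelow, if_neg (by omega), add_zero]

theorem passesBelow_eq_one {x e : Site} : ∀ {u : Site} {t : List Site},
    (u :: t).IsChain triAdj → (∀ v ∈ u :: t, v.2 < x.2) → (u :: t).getLast? = some e →
    x.1 ≤ e.1 → passesBelow x (u :: t) = if u.1 ≤ x.1 then 1 else 0
  | u, [], _, h, he, hx => by
      have hu := h u (by simp)
      obtain rfl : u = e := by simpa using he
      simp only [passesBelow]
      congr 1
      apply propext
      omega
  | u, v :: t, hc, h, he, hx => by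
      have hu := h u (by simp)
      have hv := h v (by simp)
      rw [List.isChain_cons_cons] at hc
      have hadj := triAdj_iff.1 hc.1
      rw [passesBelow, passesBelow_eq_one hc.2 (fun w hw => h w (List.mem_cons_of_mem _ hw))
        (by simpa using he) hx, edgeBelow]
      split_ifs <;> first | omega | decide

theorem passesBelow_up {x y : Site} (h1 : y.1 = x.1) (h2 : y.2 = x.2 + 1) :
    ∀ {l : List Site}, x ∉ l → passesBelow y l = passesBelow x l
  | [], _ => rfl
  | [e], h => by
      have he : ¬ (e.1 = x.1 ∧ e.2 = x.2) := fun h' => h (by simp [Prod.ext h'.1 h'.2])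
      simp only [passesBelow]
      congr 1
      apply propext
      omega
  | u :: v :: t, h => by
      have hu : ¬ (u.1 = x.1 ∧ u.2 = x.2) := fun h' => h (by simp [Prod.ext h'.1 h'.2])
      have hv : ¬ (v.1 = x.1 ∧ v.2 = x.2) := fun h' => h (by simp [Prod.ext h'.1 h'.2])
      rw [passesBelow, passesBelow, passesBelow_up h1 h2 (List.not_mem_of_not_mem_cons h)]
      congr 1
      unfold edgeBelow
      congr 1
      apply propext
      omega

theorem passesBelow_right {x y e : Site} (h1 : y.1 = x.1 + 1) (h2 : y.2 = x.2 ∨ y.2 = x.2 + 1) :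
    ∀ {u : Site} {t : List Site}, (u :: t).IsChain triAdj → x ∉ u :: t → y ∉ u :: t →
    (u :: t).getLast? = some e → x.1 < e.1 →
    passesBelow y (u :: t) = passesBelow x (u :: t) +
      if u.1 = y.1 ∧ u.2 < y.2 then 1 else 0
  | u, [], _, _, _, he, hxe => by
      obtain rfl : u = e := by simpa using he
      rw [passesBelow, passesBelow, if_neg (c := u.1 = x.1 ∧ _) (by omega), zero_add]
  | u, v :: t, hc, hx, hy, he, hxe => by
      have hux : ¬ (u.1 = x.1 ∧ u.2 = x.2) := fun h' => hx (by simp [Prod.ext h'.1 h'.2])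
      have hvx : ¬ (v.1 = x.1 ∧ v.2 = x.2) := fun h' => hx (by simp [Prod.ext h'.1 h'.2])
      have huy : ¬ (u.1 = y.1 ∧ u.2 = y.2) := fun h' => hy (by simp [Prod.ext h'.1 h'.2])
      have hvy : ¬ (v.1 = y.1 ∧ v.2 = y.2) := fun h' => hy (by simp [Prod.ext h'.1 h'.2])
      rw [List.isChain_cons_cons] at hc
      have hadj := triAdj_iff.1 hc.1
      have hedge : edgeBelow y u v + (if v.1 = y.1 ∧ v.2 < y.2 then 1 else 0) =
          edgeBelow x u v + if u.1 = y.1 ∧ u.2 < y.2 then 1 else 0 := by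
        unfold edgeBelow
        split_ifs <;> first | omega | decide
      rw [passesBelow, passesBelow,
        passesBelow_right h1 h2 hc.2 (List.not_mem_of_not_mem_cons hx)
          (List.not_mem_of_not_mem_cons hy) (by simpa using he) hxe]
      linear_combination hedge

/-- For a path starting in column `0` and ending in the last column, off the path
`passesBelow` is locally constant. -/
theorem passesBelow_eq_of_triAdj {x y u e : Site} {t : List Site} (hxy : triAdj x y)
    (hc : (u :: t).IsChain triAdj) (hx : x ∉ u :: t) (hy : y ∉ u :: t) (hu : u.1 = 0)
    (he : (u :: t).getLast? = some e) (hx0 : 0 ≤ x.1) (hy0 : 0 ≤ y.1) (hxe : x.1 ≤ e.1)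
    (hye : y.1 ≤ e.1) : passesBelow x (u :: t) = passesBelow y (u :: t) := by
  have hright : ∀ {x y : Site}, x ∉ u :: t → y ∉ u :: t → 0 ≤ x.1 → y.1 ≤ e.1 →
      y.1 = x.1 + 1 → (y.2 = x.2 ∨ y.2 = x.2 + 1) →
      passesBelow y (u :: t) = passesBelow x (u :: t) := by
    intro x y hx hy hx0 hye h1 h2
    rw [passesBelow_right h1 h2 hc hx hy he (by omega), if_neg (by omega), add_zero]
  rcases triAdj_iff.1 hxy with h | h | h | h | h | h
  · exact hright hy hx hy0 hxe h.1 (Or.inl h.2)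
  · exact (hright hx hy hx0 hye (by omega) (Or.inl h.2.symm)).symm
  · exact passesBelow_up h.1 h.2 hy
  · exact (passesBelow_up h.1.symm (by omega) hx).symm
  · exact hright hy hx hy0 hxe h.1 (Or.inr h.2)
  · exact (hright hx hy hx0 hye (by omega) (Or.inr (by omega))).symm

theorem eq_of_isChain {α β : Type*} {r : α → α → Prop} {f : α → β} {a b : α} :
    ∀ {l : List α}, l.IsChain r → (∀ x ∈ l, ∀ y ∈ l, r x y → f x = f y) →
      l.head? = some a → l.getLast? = some b → f a = f b
  | [], _, _, ha, _ => by simp at ha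
  | [x], _, _, ha, hb => by
      obtain rfl : x = a := by simpa using ha
      obtain rfl : x = b := by simpa using hb
      rfl
  | x :: y :: t, hc, hf, ha, hb => by
      obtain rfl : x = a := by simpa using ha
      rw [List.isChain_cons_cons] at hc
      rw [hf x (by simp) y (by simp) hc.1]
      exact eq_of_isChain hc.2
        (fun z hz w hw => hf z (List.mem_cons_of_mem _ hz) w (List.mem_cons_of_mem _ hw))
        rfl (by simpa using hb)

theorem not_both_crossings (n : ℕ) (ω : Config) : ¬ (ω ∈ EventA n ∧ ω ∈ EventB n) := by
  rintro ⟨⟨l, hlc, hl, ⟨u, hu, hu0⟩, e, he, hen⟩, m, hmc, hm, ⟨p, hp, hpn⟩, q, hq, hq0⟩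
  obtain ⟨t, rfl⟩ := List.head?_eq_some_iff.1 hu
  have hdisj : ∀ x ∈ m, x ∉ u :: t := fun x hx hx' => by
    have h1 := (hm x hx).2
    have h2 := (hl x hx').2
    simp_all
  have hpm := List.mem_of_head? hp
  have hqm := List.mem_of_getLast? hq
  have hpbox := (hm p hpm).1
  have heq : passesBelow p (u :: t) = passesBelow q (u :: t) := by
    refine eq_of_isChain (f := fun x => passesBelow x (u :: t)) hmc (fun x hx y hy hxy => ?_) hp hq
    have hxb := (hm x hx).1
    have hyb := (hm y hy).1
    exact passesBelow_eq_of_triAdj hxy hlc (hdisj x hx) (hdisj y hy) hu0 he hxb.1 hyb.1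
      (hen ▸ hxb.2.1) (hen ▸ hyb.2.1)
  have hbot : passesBelow q (u :: t) = 0 :=
    passesBelow_eq_zero fun v hv => hq0 ▸ (hl v hv).1.2.2.1
  have htop : passesBelow p (u :: t) = 1 := by
    rw [← passesBelow_up (x := p) (y := (p.1, p.2 + 1)) rfl rfl (hdisj p hpm),
      passesBelow_eq_one hlc (fun v hv => ?_) he (hen ▸ hpbox.2.1), if_pos (hu0 ▸ hpbox.1)]
    have := (hl v hv).1.2.2.2
    simp only
    omega
  rw [hbot, htop] at heq
  exact one_ne_zero heq

end Uniqueness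

/-- Lemma (crossing duality, deterministic part): for every configuration on the
box `[0, n]²` of the triangular lattice, exactly one of the following holds:
there is an open left–right crossing, or there is a closed top–bottom crossing. -/
theorem crossing_dichotomy (n : ℕ) (ω : Config) :
    (ω ∈ EventA n ∨ ω ∈ EventB n) ∧ ¬(ω ∈ EventA n ∧ ω ∈ EventB n) := by
  exact ⟨exists_crossing n ω, not_both_crossings n ω⟩
end
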